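/- arXiv:math/0602107 — 11 statements merged into one kernel-verified Lean document; each statement's English description precedes it below -/
import Mathlib

section
/- Let M, N, C, D be categories, let L : M ⇄ N : R and F : C ⇄ D : G be adjoint pairs (L and F the left adjoints), let ⊗_M : M × C → M and ⊗_N : N × D → N be bifunctors, and let h_M : M^op × M → C and h_N : N^op × N → D be bifunctors equipped with bijections C(c, h_M(X, Z)) ≅ M(X ⊗_M c, Z) and D(d, h_N(W, Y)) ≅ N(W ⊗_N d, Y), natural in all variables. Then there is a bijection between (i) natural transformations with components G(h_N(L(X), Y)) → h_M(X, R(Y)), natural in X ∈ M and Y ∈ N, and (ii) natural transformations with components L(X ⊗_M c) → L(X) ⊗_N F(c), natural in X ∈ M and c ∈ C. Under the correspondence, φ of type (i) corresponds to γ of type (ii) exactly when, for all X, c, Y, the map N(L(X) ⊗_N F(c), Y) → N(L(X ⊗_M c), Y) given by precomposition with γ agrees with the map obtained from φ_{X,Y} via the chain of natural bijections N(L(X) ⊗_N F(c), Y) ≅ D(F(c), h_N(L(X), Y)) ≅ C(c, G(h_N(L(X), Y))) → C(c, h_M(X, R(Y))) ≅ M(X ⊗_M c, R(Y)) ≅ N(L(X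 ⊗_M c), Y). -/
open CategoryTheory CategoryTheory.Limits Opposite

universe v₁ v₂ v₃ v₄ u₁ u₂ u₃ u₄

theorem aux_conj {M : Type u₁} {N : Type u₂} {C : Type u₃}
    [Category.{v₁} M] [Category.{v₂} N] [Category.{v₃} C]
    (A B : Mᵒᵖ × N ⥤ C) (S T : M × C ⥤ N)
    (a : ∀ (c : C) (X : M) (Y : N), (c ⟶ A.obj (op X, Y)) ≃ (S.obj (X, c) ⟶ Y))
    (b : ∀ (c : C) (X : M) (Y : N), (c ⟶ B.obj (op X, Y)) ≃ (T.obj (X, c) ⟶ Y))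
    (natA : ∀ {c c' : C} (g : c' ⟶ c) {X X' : M} (k : X' ⟶ X) {Y Y' : N} (h : Y ⟶ Y')
      (f : c ⟶ A.obj (op X, Y)),
      a c' X' Y' (g ≫ f ≫ A.map ((k.op, h) : (op X, Y) ⟶ (op X', Y')))
        = S.map ((k, g) : ((X', c') : M × C) ⟶ (X, c)) ≫ a c X Y f ≫ h)
    (natB : ∀ {c c' : C} (g : c' ⟶ c) {X X' : M} (k : X' ⟶ X) {Y Y' : N} (h : Y ⟶ Y')
      (f : c ⟶ B.obj (op X, Y)),
      b c' X' Y' (g ≫ f ≫ B.map ((k.op, h) : (op X, Y) ⟶ (op X', Y')))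
        = T.map ((k, g) : ((X', c') : M × C) ⟶ (X, c)) ≫ b c X Y f ≫ h) :
    ∃ e : (A ⟶ B) ≃ (T ⟶ S),
      ∀ (φ : A ⟶ B) (X : M) (c : C) (Y : N) (ψ : S.obj (X, c) ⟶ Y),
        (e φ).app (X, c) ≫ ψ = b c X Y ((a c X Y).symm ψ ≫ φ.app (op X, Y)) := by
  have idA : ∀ X Y, A.map ((𝟙 X, 𝟙 Y) : (X, Y) ⟶ (X, Y)) = 𝟙 _ := fun X Y => A.map_id (X, Y)
  have idB : ∀ X Y, B.map ((𝟙 X, 𝟙 Y) : (X, Y) ⟶ (X, Y)) = 𝟙 _ := fun X Y => B.map_id (X, Y)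
  have idS : ∀ X Y, S.map ((𝟙 X, 𝟙 Y) : (X, Y) ⟶ (X, Y)) = 𝟙 _ := fun X Y => S.map_id (X, Y)
  have idT : ∀ X Y, T.map ((𝟙 X, 𝟙 Y) : (X, Y) ⟶ (X, Y)) = 𝟙 _ := fun X Y => T.map_id (X, Y)
  have a1 : ∀ {c c' : C} (g : c' ⟶ c) (X : M) (Y : N) (f : c ⟶ A.obj (op X, Y)),
      a c' X Y (g ≫ f) = S.map ((𝟙 X, g) : ((X, c') : M × C) ⟶ (X, c)) ≫ a c X Y f := by
    intro c c' g X Y f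
    simpa [idA] using natA g (𝟙 X) (𝟙 Y) f
  have b1 : ∀ {c c' : C} (g : c' ⟶ c) (X : M) (Y : N) (f : c ⟶ B.obj (op X, Y)),
      b c' X Y (g ≫ f) = T.map ((𝟙 X, g) : ((X, c') : M × C) ⟶ (X, c)) ≫ b c X Y f := by
    intro c c' g X Y f
    simpa [idB] using natB g (𝟙 X) (𝟙 Y) f
  have a2 : ∀ (c : C) {X X' : M} (k : X' ⟶ X) {Y Y' : N} (h : Y ⟶ Y')
      (f : c ⟶ A.obj (op X, Y)),
      a c X' Y' (f ≫ A.map ((k.op, h) : (op X, Y) ⟶ (op X', Y')))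
        = S.map ((k, 𝟙 c) : ((X', c) : M × C) ⟶ (X, c)) ≫ a c X Y f ≫ h := by
    intro c X X' k Y Y' h f
    simpa using natA (𝟙 c) k h f
  have b2 : ∀ (c : C) {X X' : M} (k : X' ⟶ X) {Y Y' : N} (h : Y ⟶ Y')
      (f : c ⟶ B.obj (op X, Y)),
      b c X' Y' (f ≫ B.map ((k.op, h) : (op X, Y) ⟶ (op X', Y')))
        = T.map ((k, 𝟙 c) : ((X', c) : M × C) ⟶ (X, c)) ≫ b c X Y f ≫ h := by
    intro c X X' k Y Y' h f
    simpa using natB (𝟙 c) k h f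
  have phiN : ∀ (φ : A ⟶ B) {X X' : M} (k : X' ⟶ X) {Y Y' : N} (h : Y ⟶ Y'),
      A.map ((k.op, h) : (op X, Y) ⟶ (op X', Y')) ≫ φ.app (op X', Y') =
        φ.app (op X, Y) ≫ B.map ((k.op, h) : (op X, Y) ⟶ (op X', Y')) :=
    fun φ _ _ k _ _ h => φ.naturality _
  have key : ∀ (φ : A ⟶ B) (X : M) (c : C) (Y : N) (ψ : S.obj (X, c) ⟶ Y),
      b c X _ ((a c X _).symm (𝟙 (S.obj (X, c))) ≫ φ.app (op X, S.obj (X, c))) ≫ ψ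
        = b c X Y ((a c X Y).symm ψ ≫ φ.app (op X, Y)) := by
    intro φ X c Y ψ
    have h1 : (a c X Y).symm ψ = (a c X _).symm (𝟙 (S.obj (X, c))) ≫
        A.map (((𝟙 X : X ⟶ X).op, ψ) : (op X, S.obj (X, c)) ⟶ (op X, Y)) := by
      rw [Equiv.symm_apply_eq, a2]
      simp [idS]
    rw [h1, Category.assoc, phiN, ← Category.assoc, b2]
    simp [idT]
  let fwd : (A ⟶ B) → (T ⟶ S) := fun φ =>
    { app := fun p => b p.2 p.1 _ ((a p.2 p.1 _).symm (𝟙 (S.obj (p.1, p.2))) ≫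
        φ.app (op p.1, S.obj (p.1, p.2)))
      naturality := by
        rintro ⟨X, c⟩ ⟨X', c'⟩ ⟨k, g⟩
        dsimp only at k g ⊢
        refine Eq.trans ?_ (key φ X c _ (S.map ((k, g) : ((X, c) : M × C) ⟶ (X', c')))).symm
        have h1 : (a c X (S.obj (X', c'))).symm (S.map ((k, g) : ((X, c) : M × C) ⟶ (X', c')))
            = g ≫ (a c' X' _).symm (𝟙 (S.obj (X', c'))) ≫
              A.map ((k.op, 𝟙 _) : (op X', S.obj (X', c')) ⟶ (op X, S.obj (X', c'))) := by
          rw [Equiv.symm_apply_eq, natA]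
          simp
        rw [h1, Category.assoc, Category.assoc, phiN]
        have := natB g k (𝟙 _) ((a c' X' _).symm (𝟙 (S.obj (X', c'))) ≫ φ.app _)
        simp only [Category.assoc, Category.comp_id] at this
        exact this.symm }
  let bwd : (T ⟶ S) → (A ⟶ B) := fun γ =>
    { app := fun p => (b _ p.1.unop p.2).symm
        (γ.app (p.1.unop, A.obj (op p.1.unop, p.2)) ≫ a _ p.1.unop p.2 (𝟙 _))
      naturality := by
        rintro ⟨⟨X⟩, Y⟩ ⟨⟨X'⟩, Y'⟩ ⟨k, h⟩
        obtain ⟨k, rfl⟩ : ∃ k' : X' ⟶ X, k = k'.op := ⟨k.unop, rfl⟩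
        dsimp only at h ⊢
        apply (b _ X' Y').injective
        refine (b1 _ _ _ _).trans (Eq.trans ?_ (b2 _ _ _ _).symm)
        simp only [Equiv.apply_symm_apply]
        have n1 := γ.naturality ((𝟙 X', A.map ((k.op, h) : (op X, Y) ⟶ (op X', Y'))) :
          ((X', A.obj (op X, Y)) : M × C) ⟶ (X', A.obj (op X', Y')))
        have n2 := γ.naturality ((k, 𝟙 _) :
          ((X', A.obj (op X, Y)) : M × C) ⟶ (X, A.obj (op X, Y)))
        have e1 := a1 (A.map ((k.op, h) : (op X, Y) ⟶ (op X', Y'))) X' Y' (𝟙 _)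
        have e2 := a2 (A.obj (op X, Y)) k h (𝟙 _)
        rw [Category.comp_id] at e1
        rw [Category.id_comp] at e2
        erw [reassoc_of% n1, ← e1, e2, Category.assoc, reassoc_of% n2] }
  refine ⟨⟨fwd, bwd, ?_, ?_⟩, fun φ X c Y ψ => key φ X c Y ψ⟩
  · intro φ
    ext ⟨⟨X⟩, Y⟩
    refine (Equiv.symm_apply_eq _).2 ?_
    refine (key φ X _ Y _).trans ?_
    simp
  · intro γ
    ext ⟨X, c⟩
    change b c X _ ((a c X _).symm (𝟙 (S.obj (X, c))) ≫ (b _ X (S.obj (X, c))).symm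
        (γ.app (X, A.obj (op X, S.obj (X, c))) ≫ a _ X (S.obj (X, c)) (𝟙 _))) = γ.app (X, c)
    have n := γ.naturality ((𝟙 X, (a c X _).symm (𝟙 (S.obj (X, c)))) :
      ((X, c) : M × C) ⟶ (X, A.obj (op X, S.obj (X, c))))
    have e1 := a1 ((a c X _).symm (𝟙 (S.obj (X, c)))) X _ (𝟙 _)
    rw [Category.comp_id, Equiv.apply_symm_apply] at e1
    rw [b1, Equiv.apply_symm_apply, reassoc_of% n, ← e1, Category.comp_id]

/-- Proposition (i) ↔ (ii) on compatibility structures for adjoint modules: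
given the tensor/enriched-hom data `tM, hM` on `M` over `C` and `tN, hN` on `N` over `D`
(with natural tensor–hom bijections `eM`, `eN`), natural transformations
`G(hN(L X, Y)) ⟶ hM(X, R Y)` are in bijection with natural transformations
`L(X ⊗_M c) ⟶ L X ⊗_N F c`, the correspondence being characterized by the stated
compatibility of the induced maps on hom-sets. -/
theorem stmt1 {M : Type u₁} {N : Type u₂} {C : Type u₃} {D : Type u₄}
    [Category.{v₁} M] [Category.{v₂} N] [Category.{v₃} C] [Category.{v₄} D]
    (L : M ⥤ N) (R : N ⥤ M) (F : C ⥤ D) (G : D ⥤ C)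
    (adj₁ : L ⊣ R) (adj₂ : F ⊣ G)
    (tM : M × C ⥤ M) (tN : N × D ⥤ N)
    (hM : Mᵒᵖ × M ⥤ C) (hN : Nᵒᵖ × N ⥤ D)
    (eM : ∀ (c : C) (X Z : M), (c ⟶ hM.obj (op X, Z)) ≃ (tM.obj (X, c) ⟶ Z))
    (eN : ∀ (d : D) (W Y : N), (d ⟶ hN.obj (op W, Y)) ≃ (tN.obj (W, d) ⟶ Y))
    (natM : ∀ {c c' : C} (g : c' ⟶ c) {X X' : M} (k : X' ⟶ X) {Z Z' : M} (h : Z ⟶ Z')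
      (f : c ⟶ hM.obj (op X, Z)),
      eM c' X' Z' (g ≫ f ≫ hM.map ((k.op, h) : (op X, Z) ⟶ (op X', Z')))
        = tM.map ((k, g) : ((X', c') : M × C) ⟶ (X, c)) ≫ eM c X Z f ≫ h)
    (natN : ∀ {d d' : D} (g : d' ⟶ d) {W W' : N} (k : W' ⟶ W) {Y Y' : N} (h : Y ⟶ Y')
      (f : d ⟶ hN.obj (op W, Y)),
      eN d' W' Y' (g ≫ f ≫ hN.map ((k.op, h) : (op W, Y) ⟶ (op W', Y')))
        = tN.map ((k, g) : ((W', d') : N × D) ⟶ (W, d)) ≫ eN d W Y f ≫ h) :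
    ∃ e : ((L.op.prod (𝟭 N) ⋙ hN ⋙ G) ⟶ ((𝟭 Mᵒᵖ).prod R ⋙ hM)) ≃
        ((tM ⋙ L) ⟶ (L.prod F ⋙ tN)),
      ∀ (φ : (L.op.prod (𝟭 N) ⋙ hN ⋙ G) ⟶ ((𝟭 Mᵒᵖ).prod R ⋙ hM))
        (X : M) (c : C) (Y : N) (ψ : tN.obj (L.obj X, F.obj c) ⟶ Y),
        (e φ).app (X, c) ≫ ψ =
          (adj₁.homEquiv _ _).symm
            (eM c X (R.obj Y)
              ((adj₂.homEquiv c _ ((eN (F.obj c) (L.obj X) Y).symm ψ)) ≫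
                φ.app (op X, Y))) := by
  refine aux_conj (L.op.prod (𝟭 N) ⋙ hN ⋙ G) ((𝟭 Mᵒᵖ).prod R ⋙ hM) (L.prod F ⋙ tN) (tM ⋙ L)
    (fun c X Y => (adj₂.homEquiv c _).symm.trans (eN (F.obj c) (L.obj X) Y))
    (fun c X Y => (eM c X (R.obj Y)).trans (adj₁.homEquiv _ _).symm) ?_ ?_
  · intro c c' g X X' k Y Y' h f
    have := natN (F.map g) (L.map k) h ((adj₂.homEquiv c _).symm f)
    refine Eq.trans ?_ this
    refine congrArg (eN _ _ _) ?_
    refine (adj₂.homEquiv_naturality_left_symm _ _).trans ?_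
    refine congrArg (F.map g ≫ ·) ?_
    exact adj₂.homEquiv_naturality_right_symm _ _
  · intro c c' g X X' k Y Y' h f
    have := natM g k (R.map h) f
    refine (congrArg (adj₁.homEquiv _ _).symm this).trans ?_
    refine (adj₁.homEquiv_naturality_left_symm _ _).trans ?_
    refine congrArg (L.map (tM.map _) ≫ ·) ?_
    exact adj₁.homEquiv_naturality_right_symm _ _
end

section
/- Let M, N, C, D be categories, let L : M ⇄ N : R and F : C ⇄ D : G be adjoint pairs (L and F the left adjoints), let ⊗_M : M × C → M and ⊗_N : N × D → N be bifunctors, and let h_M : M^op × M → C and h_N : N^op × N → D be bifunctors equipped with bijections C(c, h_M(X, Z)) ≅ M(X ⊗_M c, Z) and D(d, h_N(W, Y)) ≅ N(W ⊗_N d, Y), natural in all variables. Then there is a bijection between (i) natural transformations with components G(h_N(L(X), Y)) → h_M(X, R(Y)), natural in X ∈ M and Y ∈ N, and (iv) natural transformations with components G(h_N(X, Y)) → h_M(R(X), R(Y)), natural in X, Y ∈ N. The correspondence sends φ of type (i) to the composite G(h_N(X, Y)) → G(h_N(L(R(X)), Y)) → h_M(R(X), R(Y)), where the first map is G applied to the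 map induced by the counit L(R(X)) → X and the second is φ. -/
open CategoryTheory CategoryTheory.Limits Opposite

universe v₁ v₂ v₃ v₄ u₁ u₂ u₃ u₄

/-- Precomposition along an adjunction, as a bijection of natural transformations. -/
def precompEquiv {A B C : Type*} [Category A] [Category B] [Category C]
    {S : B ⥤ A} {T : A ⥤ B} (adj : S ⊣ T) (P : B ⥤ C) (Q : A ⥤ C) :
    ((T ⋙ P) ⟶ Q) ≃ (P ⟶ (S ⋙ Q)) where
  toFun φ :=
    { app := fun b => P.map (adj.unit.app b) ≫ φ.app (S.obj b)
      naturality := fun b b' f => by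
        have h := φ.naturality (S.map f)
        dsimp at h ⊢
        rw [Category.assoc, ← h, ← Category.assoc, ← Category.assoc, ← P.map_comp, ← P.map_comp]
        simp }
  invFun ψ :=
    { app := fun a => ψ.app (T.obj a) ≫ Q.map (adj.counit.app a)
      naturality := fun a a' f => by
        have h := ψ.naturality (T.map f)
        dsimp at h ⊢
        rw [← Category.assoc, h, Category.assoc, Category.assoc, ← Q.map_comp, ← Q.map_comp]
        simp }
  left_inv φ := by
    ext a
    have h := φ.naturality (adj.counit.app a)
    dsimp at h ⊢
    rw [Category.assoc, ← h, ← Category.assoc, ← P.map_comp]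
    simp
  right_inv ψ := by
    ext b
    have h := ψ.naturality (adj.unit.app b)
    dsimp at h ⊢
    rw [← Category.assoc, h, Category.assoc, ← Q.map_comp]
    simp

/-- The adjunction `R.op × 1 ⊣ L.op × 1`. -/
def prodAdj {M N : Type*} [Category M] [Category N] {L : M ⥤ N} {R : N ⥤ M} (adj : L ⊣ R) :
    (R.op.prod (𝟭 N)) ⊣ (L.op.prod (𝟭 N)) where
  unit := { app := fun b => ((adj.counit.app b.1.unop).op, 𝟙 b.2)
            naturality := fun b b' f => by
              apply Prod.ext
              · exact Quiver.Hom.unop_inj (adj.counit.naturality f.1.unop).symm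
              · exact (Category.comp_id f.2).trans (Category.id_comp f.2).symm }
  counit := { app := fun a => ((adj.unit.app a.1.unop).op, 𝟙 a.2)
              naturality := fun a a' f => by
                apply Prod.ext
                · exact Quiver.Hom.unop_inj (adj.unit.naturality f.1.unop).symm
                · exact (Category.comp_id f.2).trans (Category.id_comp f.2).symm }
  left_triangle_components b := by
    apply Prod.ext
    · exact Quiver.Hom.unop_inj (adj.right_triangle_components b.1.unop)
    · exact Category.id_comp (𝟙 b.2)
  right_triangle_components a := by
    apply Prod.ext
    · exact Quiver.Hom.unop_inj (adj.left_triangle_components a.1.unop)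
    · exact Category.id_comp (𝟙 a.2)

/-- Proposition (i) ↔ (iv) on compatibility structures for adjoint modules:
natural transformations `G(hN(L X, Y)) ⟶ hM(X, R Y)` (for `X ∈ M`, `Y ∈ N`) are in
bijection with natural transformations `G(hN(X, Y)) ⟶ hM(R X, R Y)` (for `X, Y ∈ N`);
the correspondence sends `φ` to the composite
`G(hN(X, Y)) ⟶ G(hN(L(R X), Y)) ⟶ hM(R X, R Y)`, where the first map is `G` applied
to the map induced by the counit `L(R X) ⟶ X` and the second is `φ`. -/
theorem stmt2 {M : Type u₁} {N : Type u₂} {C : Type u₃} {D : Type u₄}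
    [Category.{v₁} M] [Category.{v₂} N] [Category.{v₃} C] [Category.{v₄} D]
    (L : M ⥤ N) (R : N ⥤ M) (F : C ⥤ D) (G : D ⥤ C)
    (adj₁ : L ⊣ R) (adj₂ : F ⊣ G)
    (tM : M × C ⥤ M) (tN : N × D ⥤ N)
    (hM : Mᵒᵖ × M ⥤ C) (hN : Nᵒᵖ × N ⥤ D)
    (eM : ∀ (c : C) (X Z : M), (c ⟶ hM.obj (op X, Z)) ≃ (tM.obj (X, c) ⟶ Z))
    (eN : ∀ (d : D) (W Y : N), (d ⟶ hN.obj (op W, Y)) ≃ (tN.obj (W, d) ⟶ Y))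
    (natM : ∀ {c c' : C} (g : c' ⟶ c) {X X' : M} (k : X' ⟶ X) {Z Z' : M} (h : Z ⟶ Z')
      (f : c ⟶ hM.obj (op X, Z)),
      eM c' X' Z' (g ≫ f ≫ hM.map ((k.op, h) : (op X, Z) ⟶ (op X', Z')))
        = tM.map ((k, g) : ((X', c') : M × C) ⟶ (X, c)) ≫ eM c X Z f ≫ h)
    (natN : ∀ {d d' : D} (g : d' ⟶ d) {W W' : N} (k : W' ⟶ W) {Y Y' : N} (h : Y ⟶ Y')
      (f : d ⟶ hN.obj (op W, Y)),
      eN d' W' Y' (g ≫ f ≫ hN.map ((k.op, h) : (op W, Y) ⟶ (op W', Y')))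
        = tN.map ((k, g) : ((W', d') : N × D) ⟶ (W, d)) ≫ eN d W Y f ≫ h) :
    ∃ e : ((L.op.prod (𝟭 N) ⋙ hN ⋙ G) ⟶ ((𝟭 Mᵒᵖ).prod R ⋙ hM)) ≃
        ((hN ⋙ G) ⟶ (R.op.prod R ⋙ hM)),
      ∀ (φ : (L.op.prod (𝟭 N) ⋙ hN ⋙ G) ⟶ ((𝟭 Mᵒᵖ).prod R ⋙ hM)) (X Y : N),
        (e φ).app (op X, Y) =
          G.map (hN.map (((adj₁.counit.app X).op, 𝟙 Y) :
              ((op X, Y) : Nᵒᵖ × N) ⟶ (op (L.obj (R.obj X)), Y))) ≫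
            φ.app (op (R.obj X), Y) := by
  exact ⟨precompEquiv (prodAdj adj₁) (hN ⋙ G) ((𝟭 Mᵒᵖ).prod R ⋙ hM), fun φ X Y => rfl⟩
end

section
/- Let M, N, C, D be categories, let L : M ⇄ N : R and F : C ⇄ D : G be adjoint pairs (L and F the left adjoints), and let ⊗_M : M × C → M and ⊗_N : N × D → N be bifunctors. Assume C and D are monoidal categories, G is lax monoidal (so that F acquires an oplax comonoidal transformation F(c ⊗ c') → F(c) ⊗ F(c') by adjunction), and there are given natural isomorphisms a_M : (X ⊗_M c) ⊗_M c' ≅ X ⊗_M (c ⊗ c') and a_N : (Y ⊗_N d) ⊗_N d' ≅ Y ⊗_N (d ⊗ d'). Let γ : L(X ⊗_M c) → L(X) ⊗_N F(c) be a natural transformation and let γ' : R(Y) ⊗_M G(d) → R(Y ⊗_N d) be its mate, i.e. the natural transformation whose component at (Y,d) is adjoint to L(R(Y) ⊗_M G(d)) →γ L(R(Y)) ⊗_N F(G(d)) → Y ⊗_N d (the last map using the counits). Then the following are equivalent: (a) for all X ∈ M and c, c' ∈ C, the composite L((X ⊗_M c) ⊗_M c') →γ L(X ⊗_M c) ⊗_N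 F(c') →(γ⊗1) (L(X) ⊗_N F(c)) ⊗_N F(c') →(a_N) L(X) ⊗_N (F(c) ⊗ F(c')) equals the composite L((X ⊗_M c) ⊗_M c') →L(a_M) L(X ⊗_M (c ⊗ c')) →γ L(X) ⊗_N F(c ⊗ c') → L(X) ⊗_N (F(c) ⊗ F(c')) (last map induced by the oplax structure of F); (b) for all Y ∈ N and d, d' ∈ D, the composite (R(Y) ⊗_M G(d)) ⊗_M G(d') →(γ'⊗1) R(Y ⊗_N d) ⊗_M G(d') →γ' R((Y ⊗_N d) ⊗_N d') equals the composite (R(Y) ⊗_M G(d)) ⊗_M G(d') →(a_M) R(Y) ⊗_M (G(d) ⊗ G(d')) → R(Y) ⊗_M G(d ⊗ d') →γ' R(Y ⊗_N (d ⊗ d')) →R(a_N⁻¹) R((Y ⊗_N d) ⊗_N d') (second map induced by the lax structure of G). -/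
open CategoryTheory CategoryTheory.Limits CategoryTheory.MonoidalCategory

universe v₁ v₂ v₃ v₄ u₁ u₂ u₃ u₄

theorem aux_comp {A : Type u₁} {B : Type u₂} {E : Type u₃}
    [Category.{v₁} A] [Category.{v₂} B] [Category.{v₃} E] (T : A × B ⥤ E)
    {X Y Z : A} {U V W : B} (f : X ⟶ Y) (f' : Y ⟶ Z) (g : U ⟶ V) (g' : V ⟶ W) :
    T.map ((f, g) : ((X, U) : A × B) ⟶ (Y, V)) ≫ T.map ((f', g') : ((Y, V) : A × B) ⟶ (Z, W))
      = T.map ((f ≫ f', g ≫ g') : ((X, U) : A × B) ⟶ (Z, W)) := by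
  rw [← T.map_comp]; rfl

theorem aux_comp_assoc {A : Type u₁} {B : Type u₂} {E : Type u₃}
    [Category.{v₁} A] [Category.{v₂} B] [Category.{v₃} E] (T : A × B ⥤ E)
    {X Y Z : A} {U V W : B} (f : X ⟶ Y) (f' : Y ⟶ Z) (g : U ⟶ V) (g' : V ⟶ W)
    {K : E} (k : T.obj (Z, W) ⟶ K) :
    T.map ((f, g) : ((X, U) : A × B) ⟶ (Y, V)) ≫
      T.map ((f', g') : ((Y, V) : A × B) ⟶ (Z, W)) ≫ k
      = T.map ((f ≫ f', g ≫ g') : ((X, U) : A × B) ⟶ (Z, W)) ≫ k := by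
  rw [← Category.assoc, aux_comp]

theorem aux_id {A : Type u₁} {B : Type u₂} {E : Type u₃}
    [Category.{v₁} A] [Category.{v₂} B] [Category.{v₃} E] (T : A × B ⥤ E) (X : A) (U : B) :
    T.map ((𝟙 X, 𝟙 U) : ((X, U) : A × B) ⟶ (X, U)) = 𝟙 (T.obj (X, U)) :=
  T.map_id (X, U)

/-- The associativity equivalence (a) ⇔ (b) in the definition of adjoint modules:
given a natural transformation `γ : L(X ⊗_M c) ⟶ L X ⊗_N F c` with mate
`γ' : R Y ⊗_M G d ⟶ R(Y ⊗_N d)`, the associativity condition for `γ` (with respect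
to the given associativity isomorphisms and the oplax comonoidal structure on `F`
obtained by adjunction from the lax monoidal structure on `G`) holds if and only if
the associativity condition for `γ'` (with respect to the lax monoidal structure on
`G`) holds. -/
theorem stmt3 {M : Type u₁} {N : Type u₂} {C : Type u₃} {D : Type u₄}
    [Category.{v₁} M] [Category.{v₂} N] [Category.{v₃} C] [Category.{v₄} D]
    [MonoidalCategory C] [MonoidalCategory D]
    (L : M ⥤ N) (R : N ⥤ M) (F : C ⥤ D) (G : D ⥤ C)
    (adj₁ : L ⊣ R) (adj₂ : F ⊣ G) [G.LaxMonoidal]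
    (tM : M × C ⥤ M) (tN : N × D ⥤ N)
    (aM : ∀ (X : M) (c c' : C), tM.obj (tM.obj (X, c), c') ≅ tM.obj (X, c ⊗ c'))
    (aM_nat : ∀ {X X' : M} (f : X ⟶ X') {c₁ c₂ : C} (g : c₁ ⟶ c₂) {c₁' c₂' : C}
      (g' : c₁' ⟶ c₂'),
      tM.map ((tM.map ((f, g) : ((X, c₁) : M × C) ⟶ (X', c₂)), g') :
          ((tM.obj (X, c₁), c₁') : M × C) ⟶ (tM.obj (X', c₂), c₂')) ≫
          (aM X' c₂ c₂').hom
        = (aM X c₁ c₁').hom ≫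
            tM.map ((f, g ⊗ₘ g') : ((X, c₁ ⊗ c₁') : M × C) ⟶ (X', c₂ ⊗ c₂')))
    (aN : ∀ (Y : N) (d d' : D), tN.obj (tN.obj (Y, d), d') ≅ tN.obj (Y, d ⊗ d'))
    (aN_nat : ∀ {Y Y' : N} (f : Y ⟶ Y') {d₁ d₂ : D} (g : d₁ ⟶ d₂) {d₁' d₂' : D}
      (g' : d₁' ⟶ d₂'),
      tN.map ((tN.map ((f, g) : ((Y, d₁) : N × D) ⟶ (Y', d₂)), g') :
          ((tN.obj (Y, d₁), d₁') : N × D) ⟶ (tN.obj (Y', d₂), d₂')) ≫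
          (aN Y' d₂ d₂').hom
        = (aN Y d₁ d₁').hom ≫
            tN.map ((f, g ⊗ₘ g') : ((Y, d₁ ⊗ d₁') : N × D) ⟶ (Y', d₂ ⊗ d₂')))
    (γ : (tM ⋙ L) ⟶ (L.prod F ⋙ tN))
    (γ' : (R.prod G ⋙ tM) ⟶ (tN ⋙ R))
    (hγ' : ∀ (Y : N) (d : D),
      γ'.app (Y, d) =
        (adj₁.homEquiv _ _) (γ.app (R.obj Y, G.obj d) ≫
          tN.map ((adj₁.counit.app Y, adj₂.counit.app d) :
            ((L.obj (R.obj Y), F.obj (G.obj d)) : N × D) ⟶ (Y, d)))) :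
    (∀ (X : M) (c c' : C),
      γ.app (tM.obj (X, c), c') ≫
        tN.map ((γ.app (X, c), 𝟙 (F.obj c')) :
          ((L.obj (tM.obj (X, c)), F.obj c') : N × D) ⟶
            (tN.obj (L.obj X, F.obj c), F.obj c')) ≫
        (aN (L.obj X) (F.obj c) (F.obj c')).hom
      = L.map (aM X c c').hom ≫ γ.app (X, c ⊗ c') ≫
          tN.map ((𝟙 (L.obj X), (adj₂.homEquiv _ _).symm
              ((adj₂.unit.app c ⊗ₘ adj₂.unit.app c') ≫
                Functor.LaxMonoidal.μ G (F.obj c) (F.obj c'))) :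
            ((L.obj X, F.obj (c ⊗ c')) : N × D) ⟶ (L.obj X, F.obj c ⊗ F.obj c')))
    ↔
    (∀ (Y : N) (d d' : D),
      tM.map ((γ'.app (Y, d), 𝟙 (G.obj d')) :
          ((tM.obj (R.obj Y, G.obj d), G.obj d') : M × C) ⟶
            (R.obj (tN.obj (Y, d)), G.obj d')) ≫
        γ'.app (tN.obj (Y, d), d')
      = (aM (R.obj Y) (G.obj d) (G.obj d')).hom ≫
          tM.map ((𝟙 (R.obj Y), Functor.LaxMonoidal.μ G d d') :
            ((R.obj Y, G.obj d ⊗ G.obj d') : M × C) ⟶ (R.obj Y, G.obj (d ⊗ d'))) ≫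
          γ'.app (Y, d ⊗ d') ≫ R.map (aN Y d d').inv) := by
  have γnat : ∀ {X X' : M} {c c' : C} (f : X ⟶ X') (g : c ⟶ c'),
      L.map (tM.map ((f, g) : ((X, c) : M × C) ⟶ (X', c'))) ≫ γ.app (X', c')
        = γ.app (X, c) ≫ tN.map ((L.map f, F.map g) :
          ((L.obj X, F.obj c) : N × D) ⟶ (L.obj X', F.obj c')) := fun {X X' c c'} f g =>
    γ.naturality ((f, g) : ((X, c) : M × C) ⟶ (X', c'))
  have mate : ∀ (Y : N) (d : D), L.map (γ'.app (Y, d)) ≫ adj₁.counit.app (tN.obj (Y, d)) =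
      γ.app (R.obj Y, G.obj d) ≫ tN.map ((adj₁.counit.app Y, adj₂.counit.app d) :
            ((L.obj (R.obj Y), F.obj (G.obj d)) : N × D) ⟶ (Y, d)) := by
    intro Y d
    have h := congrArg (adj₁.homEquiv _ _).symm (hγ' Y d)
    exact (adj₁.homEquiv_counit _ _ _).symm.trans (h.trans (Equiv.symm_apply_apply _ _))
  let := adj₂.leftAdjointOplaxMonoidal
  let δ : ∀ c c' : C, F.obj (c ⊗ c') ⟶ F.obj c ⊗ F.obj c' := fun c c' =>
    (adj₂.homEquiv _ _).symm ((adj₂.unit.app c ⊗ₘ adj₂.unit.app c') ≫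
                Functor.LaxMonoidal.μ G (F.obj c) (F.obj c'))
  have δnat : ∀ {c₁ c₂ c₁' c₂' : C} (g : c₁ ⟶ c₂) (g' : c₁' ⟶ c₂'),
      F.map (g ⊗ₘ g') ≫ δ c₂ c₂' = δ c₁ c₁' ≫ (F.map g ⊗ₘ F.map g') := fun g g' =>
    (Functor.OplaxMonoidal.δ_natural F g g').symm
  have δε : ∀ d d' : D, δ (G.obj d) (G.obj d') ≫ (adj₂.counit.app d ⊗ₘ adj₂.counit.app d')
      = F.map (Functor.LaxMonoidal.μ G d d') ≫ adj₂.counit.app (d ⊗ d') := fun d d' =>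
    (adj₂.map_μ_comp_counit_app_tensor d d').symm
  let A : ∀ (X : M) (c c' : C), L.obj (tM.obj (tM.obj (X, c), c')) ⟶
      tN.obj (L.obj X, F.obj c ⊗ F.obj c') := fun X c c' =>
      γ.app (tM.obj (X, c), c') ≫
        tN.map ((γ.app (X, c), 𝟙 (F.obj c')) :
          ((L.obj (tM.obj (X, c)), F.obj c') : N × D) ⟶
            (tN.obj (L.obj X, F.obj c), F.obj c')) ≫
        (aN (L.obj X) (F.obj c) (F.obj c')).hom
  let B : ∀ (X : M) (c c' : C), L.obj (tM.obj (tM.obj (X, c), c')) ⟶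
      tN.obj (L.obj X, F.obj c ⊗ F.obj c') := fun X c c' =>
      L.map (aM X c c').hom ≫ γ.app (X, c ⊗ c') ≫
          tN.map ((𝟙 (L.obj X), δ c c') :
            ((L.obj X, F.obj (c ⊗ c')) : N × D) ⟶ (L.obj X, F.obj c ⊗ F.obj c'))
  have Anat : ∀ {X X' : M} (f : X ⟶ X') {c₁ c₂ : C} (g : c₁ ⟶ c₂) {c₁' c₂' : C}
      (g' : c₁' ⟶ c₂'),
      L.map (tM.map ((tM.map ((f, g) : ((X, c₁) : M × C) ⟶ (X', c₂)), g') :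
          ((tM.obj (X, c₁), c₁') : M × C) ⟶ (tM.obj (X', c₂), c₂'))) ≫ A X' c₂ c₂'
        = A X c₁ c₁' ≫ tN.map ((L.map f, F.map g ⊗ₘ F.map g') :
          ((L.obj X, F.obj c₁ ⊗ F.obj c₁') : N × D) ⟶ (L.obj X', F.obj c₂ ⊗ F.obj c₂')) := by
    intro X X' f c₁ c₂ g c₁' c₂' g'
    simp only [A, Category.assoc]
    erw [← aN_nat, reassoc_of% (γnat (tM.map ((f, g) : ((X, c₁) : M × C) ⟶ (X', c₂))) g'),
      aux_comp_assoc tN, aux_comp_assoc tN]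
    rw [γnat, Category.comp_id, Category.id_comp]
  have Bnat : ∀ {X X' : M} (f : X ⟶ X') {c₁ c₂ : C} (g : c₁ ⟶ c₂) {c₁' c₂' : C}
      (g' : c₁' ⟶ c₂'),
      L.map (tM.map ((tM.map ((f, g) : ((X, c₁) : M × C) ⟶ (X', c₂)), g') :
          ((tM.obj (X, c₁), c₁') : M × C) ⟶ (tM.obj (X', c₂), c₂'))) ≫ B X' c₂ c₂'
        = B X c₁ c₁' ≫ tN.map ((L.map f, F.map g ⊗ₘ F.map g') :
          ((L.obj X, F.obj c₁ ⊗ F.obj c₁') : N × D) ⟶ (L.obj X', F.obj c₂ ⊗ F.obj c₂')) := by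
    intro X X' f c₁ c₂ g c₁' c₂' g'
    simp only [B, Category.assoc]
    rw [← L.map_comp_assoc, aM_nat, L.map_comp_assoc, reassoc_of% (γnat f (g ⊗ₘ g'))]
    erw [aux_comp tN, aux_comp tN]
    rw [δnat, Category.comp_id, Category.id_comp]
  have key1 : ∀ (Y : N) (d d' : D),
      L.map (tM.map ((γ'.app (Y, d), 𝟙 (G.obj d')) :
          ((tM.obj (R.obj Y, G.obj d), G.obj d') : M × C) ⟶
            (R.obj (tN.obj (Y, d)), G.obj d')) ≫
        γ'.app (tN.obj (Y, d), d')) ≫ adj₁.counit.app _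
      = A (R.obj Y) (G.obj d) (G.obj d') ≫
        tN.map ((adj₁.counit.app Y, adj₂.counit.app d ⊗ₘ adj₂.counit.app d') :
          ((L.obj (R.obj Y), F.obj (G.obj d) ⊗ F.obj (G.obj d')) : N × D) ⟶ (Y, d ⊗ d')) ≫
        (aN Y d d').inv := by
    intro Y d d'
    have e : (aN (L.obj (R.obj Y)) (F.obj (G.obj d)) (F.obj (G.obj d'))).hom ≫
        tN.map ((adj₁.counit.app Y, adj₂.counit.app d ⊗ₘ adj₂.counit.app d') :
          ((L.obj (R.obj Y), F.obj (G.obj d) ⊗ F.obj (G.obj d')) : N × D) ⟶ (Y, d ⊗ d')) ≫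
        (aN Y d d').inv = tN.map ((tN.map ((adj₁.counit.app Y, adj₂.counit.app d) :
          ((L.obj (R.obj Y), F.obj (G.obj d)) : N × D) ⟶ (Y, d)), adj₂.counit.app d') :
          ((tN.obj (L.obj (R.obj Y), F.obj (G.obj d)), F.obj (G.obj d')) : N × D) ⟶
            (tN.obj (Y, d), d')) := by
      rw [← Category.assoc, Iso.comp_inv_eq]
      exact (aN_nat _ _ _).symm
    simp only [A, Category.assoc]
    erw [e, aux_comp tN, L.map_comp, Category.assoc, mate, reassoc_of% (γnat (γ'.app (Y, d)) (𝟙 (G.obj d'))),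
      aux_comp tN, mate]
    simp
  have key2 : ∀ (Y : N) (d d' : D),
      L.map ((aM (R.obj Y) (G.obj d) (G.obj d')).hom ≫
          tM.map ((𝟙 (R.obj Y), Functor.LaxMonoidal.μ G d d') :
            ((R.obj Y, G.obj d ⊗ G.obj d') : M × C) ⟶ (R.obj Y, G.obj (d ⊗ d'))) ≫
          γ'.app (Y, d ⊗ d') ≫ R.map (aN Y d d').inv) ≫ adj₁.counit.app _
      = B (R.obj Y) (G.obj d) (G.obj d') ≫
        tN.map ((adj₁.counit.app Y, adj₂.counit.app d ⊗ₘ adj₂.counit.app d') :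
          ((L.obj (R.obj Y), F.obj (G.obj d) ⊗ F.obj (G.obj d')) : N × D) ⟶ (Y, d ⊗ d')) ≫
        (aN Y d d').inv := by
    intro Y d d'
    simp only [B, Category.assoc]
    rw [aux_comp_assoc tN, δε, Category.id_comp]
    simp only [L.map_comp, Category.assoc]
    erw [adj₁.counit_naturality, reassoc_of% (mate Y (d ⊗ d')),
      reassoc_of% (γnat (𝟙 (R.obj Y)) (Functor.LaxMonoidal.μ G d d')), aux_comp_assoc tN]
    simp
  change (∀ X c c', A X c c' = B X c c') ↔ _
  constructor
  · intro h Y d d'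
    apply (adj₁.homEquiv _ _).symm.injective
    rw [adj₁.homEquiv_counit, adj₁.homEquiv_counit]
    erw [key1, key2, h]
  · intro h X c c'
    have h1 := congrArg (fun k => L.map k ≫ adj₁.counit.app _) (h (L.obj X) (F.obj c) (F.obj c'))
    have h2 := (key1 _ _ _).symm.trans (h1.trans (key2 _ _ _))
    rw [← Category.assoc, ← Category.assoc, cancel_mono] at h2
    have h3 := congrArg (fun k => L.map (tM.map ((tM.map ((adj₁.unit.app X, adj₂.unit.app c) :
      ((X, c) : M × C) ⟶ (R.obj (L.obj X), G.obj (F.obj c))), adj₂.unit.app c') :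
          ((tM.obj (X, c), c') : M × C) ⟶
          (tM.obj (R.obj (L.obj X), G.obj (F.obj c)), G.obj (F.obj c')))) ≫ k) h2
    dsimp only at h3
    have t : tN.map ((L.map (adj₁.unit.app X),
          F.map (adj₂.unit.app c) ⊗ₘ F.map (adj₂.unit.app c')) :
          ((L.obj X, F.obj c ⊗ F.obj c') : N × D) ⟶
          (L.obj (R.obj (L.obj X)), F.obj (G.obj (F.obj c)) ⊗ F.obj (G.obj (F.obj c')))) ≫
        tN.map ((adj₁.counit.app (L.obj X),
          adj₂.counit.app (F.obj c) ⊗ₘ adj₂.counit.app (F.obj c')) :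
          ((L.obj (R.obj (L.obj X)), F.obj (G.obj (F.obj c)) ⊗ F.obj (G.obj (F.obj c'))) : N × D)
            ⟶ (L.obj X, F.obj c ⊗ F.obj c')) = 𝟙 _ := by
      rw [aux_comp, MonoidalCategory.tensorHom_comp_tensorHom]
      simp only [Adjunction.left_triangle_components, MonoidalCategory.id_tensorHom_id]
      exact aux_id tN _ _
    have hA := Anat (adj₁.unit.app X) (adj₂.unit.app c) (adj₂.unit.app c')
    have hB := Bnat (adj₁.unit.app X) (adj₂.unit.app c) (adj₂.unit.app c')
    have hA' := (reassoc_of% hA) (tN.map ((adj₁.counit.app (L.obj X),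
          adj₂.counit.app (F.obj c) ⊗ₘ adj₂.counit.app (F.obj c')) :
          ((L.obj (R.obj (L.obj X)), F.obj (G.obj (F.obj c)) ⊗ F.obj (G.obj (F.obj c'))) : N × D)
            ⟶ (L.obj X, F.obj c ⊗ F.obj c')))
    have hB' := (reassoc_of% hB) (tN.map ((adj₁.counit.app (L.obj X),
          adj₂.counit.app (F.obj c) ⊗ₘ adj₂.counit.app (F.obj c')) :
          ((L.obj (R.obj (L.obj X)), F.obj (G.obj (F.obj c)) ⊗ F.obj (G.obj (F.obj c'))) : N × D)
            ⟶ (L.obj X, F.obj c ⊗ F.obj c')))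
    erw [t, Category.comp_id] at hA' hB'
    exact hA'.symm.trans (h3.trans hB')
end

section
/- Let M, N, C, D be categories, let L : M ⇄ N : R and F : C ⇄ D : G be adjoint pairs (L and F the left adjoints), and let ⊗_M : M × C → M and ⊗_N : N × D → N be bifunctors. Assume C and D are monoidal with units 1_C and 1_D, G is lax monoidal with unit map η : 1_C → G(1_D) (with adjoint ε : F(1_C) → 1_D), and there are given natural isomorphisms r_M : X ⊗_M 1_C ≅ X and r_N : Y ⊗_N 1_D ≅ Y. Let γ : L(X ⊗_M c) → L(X) ⊗_N F(c) be a natural transformation with mate γ' : R(Y) ⊗_M G(d) → R(Y ⊗_N d) (whose component at (Y,d) is adjoint to L(R(Y) ⊗_M G(d)) →γ L(R(Y)) ⊗_N F(G(d)) → Y ⊗_N d via the counits). Then the following are equivalent: (a) for every X ∈ M, the composite L(X) →L(r_M⁻¹) L(X ⊗_M 1_C) →γ L(X) ⊗_N F(1_C) →(1⊗ε) L(X) ⊗_N 1_D equals r_N⁻¹ : L(X) → L(X) ⊗_N 1_D; (b) for every Y ∈ N, the composite R(Y) →r_M⁻¹ R(Y) ⊗_M 1_C →(1⊗η) R(Y)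 ⊗_M G(1_D) →γ' R(Y ⊗_N 1_D) equals R(r_N⁻¹) : R(Y) → R(Y ⊗_N 1_D). -/
open CategoryTheory CategoryTheory.Limits CategoryTheory.MonoidalCategory

universe v₁ v₂ v₃ v₄ u₁ u₂ u₃ u₄

/-- The unit equivalence (a) ⇔ (b) in the definition of adjoint modules:
given a natural transformation `γ : L(X ⊗_M c) ⟶ L X ⊗_N F c` with mate
`γ' : R Y ⊗_M G d ⟶ R(Y ⊗_N d)`, and given unit isomorphisms
`r_M : X ⊗_M 1_C ≅ X`, `r_N : Y ⊗_N 1_D ≅ Y`, the unit condition for `γ`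
(involving the map `ε : F(1_C) ⟶ 1_D` adjoint to the lax monoidal unit
`η : 1_C ⟶ G(1_D)`) holds if and only if the unit condition for `γ'`
(involving `η`) holds. -/
theorem stmt4 {M : Type u₁} {N : Type u₂} {C : Type u₃} {D : Type u₄}
    [Category.{v₁} M] [Category.{v₂} N] [Category.{v₃} C] [Category.{v₄} D]
    [MonoidalCategory C] [MonoidalCategory D]
    (L : M ⥤ N) (R : N ⥤ M) (F : C ⥤ D) (G : D ⥤ C)
    (adj₁ : L ⊣ R) (adj₂ : F ⊣ G) [G.LaxMonoidal]
    (tM : M × C ⥤ M) (tN : N × D ⥤ N)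
    (rM : ∀ X : M, tM.obj (X, 𝟙_ C) ≅ X)
    (rM_nat : ∀ {X X' : M} (f : X ⟶ X'),
      tM.map ((f, 𝟙 (𝟙_ C)) : ((X, 𝟙_ C) : M × C) ⟶ (X', 𝟙_ C)) ≫ (rM X').hom
        = (rM X).hom ≫ f)
    (rN : ∀ Y : N, tN.obj (Y, 𝟙_ D) ≅ Y)
    (rN_nat : ∀ {Y Y' : N} (f : Y ⟶ Y'),
      tN.map ((f, 𝟙 (𝟙_ D)) : ((Y, 𝟙_ D) : N × D) ⟶ (Y', 𝟙_ D)) ≫ (rN Y').hom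
        = (rN Y).hom ≫ f)
    (γ : (tM ⋙ L) ⟶ (L.prod F ⋙ tN))
    (γ' : (R.prod G ⋙ tM) ⟶ (tN ⋙ R))
    (hγ' : ∀ (Y : N) (d : D),
      γ'.app (Y, d) =
        (adj₁.homEquiv _ _) (γ.app (R.obj Y, G.obj d) ≫
          tN.map ((adj₁.counit.app Y, adj₂.counit.app d) :
            ((L.obj (R.obj Y), F.obj (G.obj d)) : N × D) ⟶ (Y, d)))) :
    (∀ X : M,
      L.map (rM X).inv ≫ γ.app (X, 𝟙_ C) ≫
        tN.map ((𝟙 (L.obj X), (adj₂.homEquiv _ _).symm (Functor.LaxMonoidal.ε G)) :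
          ((L.obj X, F.obj (𝟙_ C)) : N × D) ⟶ (L.obj X, 𝟙_ D))
      = (rN (L.obj X)).inv)
    ↔
    (∀ Y : N,
      (rM (R.obj Y)).inv ≫
        tM.map ((𝟙 (R.obj Y), Functor.LaxMonoidal.ε G) :
          ((R.obj Y, 𝟙_ C) : M × C) ⟶ (R.obj Y, G.obj (𝟙_ D))) ≫
        γ'.app (Y, 𝟙_ D)
      = R.map (rN Y).inv) := by
  have rM_inv : ∀ {X X' : M} (f : X ⟶ X'),
      (rM X).inv ≫ tM.map ((f, 𝟙 (𝟙_ C)) : ((X, 𝟙_ C) : M × C) ⟶ (X', 𝟙_ C))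
        = f ≫ (rM X').inv := by
    intro X X' f
    rw [Iso.inv_comp_eq, ← Category.assoc, Iso.eq_comp_inv, rM_nat]
  have rN_inv : ∀ {Y Y' : N} (f : Y ⟶ Y'),
      (rN Y).inv ≫ tN.map ((f, 𝟙 (𝟙_ D)) : ((Y, 𝟙_ D) : N × D) ⟶ (Y', 𝟙_ D))
        = f ≫ (rN Y').inv := by
    intro Y Y' f
    rw [Iso.inv_comp_eq, ← Category.assoc, Iso.eq_comp_inv, rN_nat]
  let e : F.obj (𝟙_ C) ⟶ 𝟙_ D := (adj₂.homEquiv _ _).symm (Functor.LaxMonoidal.ε G)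
  have he : e = F.map (Functor.LaxMonoidal.ε G) ≫ adj₂.counit.app (𝟙_ D) :=
    adj₂.homEquiv_counit _ _ _
  let A : ∀ X : M, L.obj X ⟶ tN.obj (L.obj X, 𝟙_ D) := fun X =>
    L.map (rM X).inv ≫ γ.app (X, 𝟙_ C) ≫
      tN.map ((𝟙 (L.obj X), e) : ((L.obj X, F.obj (𝟙_ C)) : N × D) ⟶ (L.obj X, 𝟙_ D))
  have nat : ∀ {X X' : M} {c c' : C} (f : X ⟶ X') (g : c ⟶ c'),
      L.map (tM.map ((f, g) : ((X, c) : M × C) ⟶ (X', c'))) ≫ γ.app (X', c')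
      = γ.app (X, c) ≫ tN.map ((L.map f, F.map g) :
          ((L.obj X, F.obj c) : N × D) ⟶ (L.obj X', F.obj c')) := by
    intro X X' c c' f g
    exact γ.naturality ((f, g) : ((X, c) : M × C) ⟶ (X', c'))
  have tNc : ∀ {Y Y' Y'' : N} {d d' d'' : D} (f : Y ⟶ Y') (f' : Y' ⟶ Y'')
      (g : d ⟶ d') (g' : d' ⟶ d''),
      tN.map ((f, g) : ((Y, d) : N × D) ⟶ (Y', d')) ≫
        tN.map ((f', g') : ((Y', d') : N × D) ⟶ (Y'', d''))
      = tN.map ((f ≫ f', g ≫ g') : ((Y, d) : N × D) ⟶ (Y'', d'')) := by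
    intros
    rw [← tN.map_comp]; rfl
  have Anat : ∀ {X X' : M} (f : X ⟶ X'), L.map f ≫ A X' = A X ≫
      tN.map ((L.map f, 𝟙 (𝟙_ D)) : ((L.obj X, 𝟙_ D) : N × D) ⟶ (L.obj X', 𝟙_ D)) := by
    intro X X' f
    simp only [A, Category.assoc, tNc, Category.id_comp, Category.comp_id]
    rw [← Category.assoc, ← L.map_comp, ← rM_inv, L.map_comp, Category.assoc,
      ← Category.assoc (L.map (tM.map _)), nat, Category.assoc, tNc]
    simp
  have key : ∀ Y : N, (rM (R.obj Y)).inv ≫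
        tM.map ((𝟙 (R.obj Y), Functor.LaxMonoidal.ε G) :
          ((R.obj Y, 𝟙_ C) : M × C) ⟶ (R.obj Y, G.obj (𝟙_ D))) ≫
        γ'.app (Y, 𝟙_ D) = adj₁.homEquiv _ _ (A (R.obj Y) ≫
          tN.map ((adj₁.counit.app Y, 𝟙 (𝟙_ D)) :
            ((L.obj (R.obj Y), 𝟙_ D) : N × D) ⟶ (Y, 𝟙_ D))) := by
    intro Y
    rw [hγ']
    erw [← adj₁.homEquiv_naturality_left, ← adj₁.homEquiv_naturality_left]
    congr 1
    simp only [A, Category.assoc, tNc, Category.id_comp, Category.comp_id]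
    rw [← Category.assoc (L.map (tM.map _)), nat, Category.assoc, tNc, he]
    simp
  have key2 : ∀ Y : N, R.map (rN Y).inv =
      adj₁.homEquiv _ _ (adj₁.counit.app Y ≫ (rN Y).inv) := by
    intro Y
    simp [Adjunction.homEquiv_unit]
  change (∀ X, A X = (rN (L.obj X)).inv) ↔ _
  constructor
  · intro h Y
    rw [key, key2, h, rN_inv]
    rfl
  · intro h X
    have h1 := h (L.obj X)
    rw [key, key2] at h1
    have h2 := (adj₁.homEquiv _ _).injective h1
    obtain ⟨u, hu⟩ : ∃ u : X ⟶ R.obj (L.obj X), u = adj₁.unit.app X := ⟨_, rfl⟩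
    obtain ⟨k, hk⟩ : ∃ k : L.obj (R.obj (L.obj X)) ⟶ L.obj X,
      k = adj₁.counit.app (L.obj X) := ⟨_, rfl⟩
    have tri : L.map u ≫ k = 𝟙 (L.obj X) := by
      rw [hu, hk]; exact adj₁.left_triangle_components X
    have h2' : A (R.obj (L.obj X)) ≫ tN.map ((k, 𝟙 (𝟙_ D)) :
        ((L.obj (R.obj (L.obj X)), 𝟙_ D) : N × D) ⟶ (L.obj X, 𝟙_ D))
        = k ≫ (rN (L.obj X)).inv := by
      rw [hk]; exact h2
    have h3 : L.map u ≫ A (R.obj (L.obj X)) ≫ tN.map ((k, 𝟙 (𝟙_ D)) :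
        ((L.obj (R.obj (L.obj X)), 𝟙_ D) : N × D) ⟶ (L.obj X, 𝟙_ D))
        = L.map u ≫ k ≫ (rN (L.obj X)).inv := by rw [h2']
    rw [← Category.assoc, Anat, Category.assoc, tNc, ← Category.assoc (L.map _), tri,
      Category.id_comp, Category.id_comp] at h3
    rw [← h3]
    exact (Category.comp_id _).symm.trans (congrArg (A X ≫ ·) (tN.map_id _).symm)
end

section
/- Let C be a monoidal category which is complete and cocomplete, and assume that for every object X of C the functors X ⊗ (−) and (−) ⊗ X preserve filtered colimits. Then the category Mon(C) of monoid objects in C has all small colimits. -/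
open CategoryTheory CategoryTheory.Limits CategoryTheory.MonoidalCategory

universe v u

namespace Stmt6Aux

open MonObj

variable {C : Type u} [Category.{v} C] [MonoidalCategory C]

/-- An approximation to a monoid. -/
structure Stage (C : Type u) [Category.{v} C] [MonoidalCategory C] where
  X : C
  Y : C
  e : 𝟙_ C ⟶ X
  i : X ⟶ Y
  m : X ⊗ X ⟶ Y

/-- Compatibility of a map with the partial operations. -/
def Stage.Compat (S : Stage C) (M : Mon C) (f : S.Y ⟶ M.X) : Prop :=
  S.e ≫ S.i ≫ f = η[M.X] ∧ S.m ≫ f = ((S.i ≫ f) ⊗ₘ (S.i ≫ f)) ≫ μ[M.X]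

lemma exists_coeq [HasColimits C] {R A : C} (f g : R ⟶ A) :
    ∃ (Q : C) (q : A ⟶ Q), f ≫ q = g ≫ q ∧ Epi q ∧
      ∀ (M : C) (h : A ⟶ M), f ≫ h = g ≫ h → ∃ h' : Q ⟶ M, q ≫ h' = h :=
  ⟨coequalizer f g, coequalizer.π f g, coequalizer.condition f g, inferInstance,
    fun _ h w => ⟨coequalizer.desc h w, coequalizer.π_desc h w⟩⟩

lemma coprod_eq [HasColimits C] {A B T : C} {f f' : A ⟶ T} {g g' : B ⟶ T}
    (h : coprod.desc f g = coprod.desc f' g') : f = f' ∧ g = g' :=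
  ⟨by rw [← coprod.inl_desc f g, h, coprod.inl_desc],
    by rw [← coprod.inr_desc f g, h, coprod.inr_desc]⟩

lemma sigma_eq [HasColimits C] {J : Type v} {A : J → C} {T : C} {f g : ∀ j, A j ⟶ T}
    (h : Sigma.desc f = Sigma.desc g) (j : J) : f j = g j := by
  rw [← Sigma.ι_desc f j, h, Sigma.ι_desc]

lemma sigma_comp [HasColimits C] {J : Type v} {A : J → C} {T U : C} (f : ∀ j, A j ⟶ T)
    (q : T ⟶ U) : Sigma.desc f ≫ q = Sigma.desc (fun j => f j ≫ q) := by
  apply Sigma.hom_ext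
  intro j
  rw [Sigma.ι_desc_assoc, Sigma.ι_desc]

lemma assoc_aux (M : Mon C) {X : C} (g : X ⟶ M.X) :
    (((g ⊗ₘ g) ≫ μ[M.X]) ⊗ₘ g) ≫ μ[M.X] =
      (α_ X X X).hom ≫ (g ⊗ₘ ((g ⊗ₘ g) ≫ μ[M.X])) ≫ μ[M.X] := by
  have h1 : (((g ⊗ₘ g) ≫ μ[M.X]) ⊗ₘ g) = ((g ⊗ₘ g) ⊗ₘ g) ≫ (μ[M.X] ▷ M.X) := by
    rw [← tensorHom_id, tensorHom_comp_tensorHom, Category.comp_id]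
  have h2 : (g ⊗ₘ ((g ⊗ₘ g) ≫ μ[M.X])) = (g ⊗ₘ (g ⊗ₘ g)) ≫ (M.X ◁ μ[M.X]) := by
    rw [← id_tensorHom, tensorHom_comp_tensorHom, Category.comp_id]
  rw [h1, h2, Category.assoc, MonObj.mul_assoc, Category.assoc,
    ← associator_naturality_assoc]

lemma one_aux (M : Mon C) {Y : C} (e : 𝟙_ C ⟶ Y) (f : Y ⟶ M.X) (h : e ≫ f = η[M.X]) :
    e ▷ Y ≫ (f ⊗ₘ f) ≫ μ[M.X] = (λ_ Y).hom ≫ f := by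
  rw [← tensorHom_id, tensorHom_comp_tensorHom_assoc, h, Category.id_comp,
    MonoidalCategory.tensorHom_def', Category.assoc, MonObj.one_mul, leftUnitor_naturality]

lemma one_aux' (M : Mon C) {Y : C} (e : 𝟙_ C ⟶ Y) (f : Y ⟶ M.X) (h : e ≫ f = η[M.X]) :
    Y ◁ e ≫ (f ⊗ₘ f) ≫ μ[M.X] = (ρ_ Y).hom ≫ f := by
  rw [← id_tensorHom, tensorHom_comp_tensorHom_assoc, h, Category.id_comp,
    MonoidalCategory.tensorHom_def, Category.assoc, MonObj.mul_one, rightUnitor_naturality]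

lemma exists_step [HasColimits C] (S : Stage C) :
    ∃ (Z : C) (i' : S.Y ⟶ Z) (m' : S.Y ⊗ S.Y ⟶ Z),
      S.m ≫ i' = (S.i ⊗ₘ S.i) ≫ m' ∧
      (S.m ⊗ₘ S.i) ≫ m' = (α_ _ _ _).hom ≫ (S.i ⊗ₘ S.m) ≫ m' ∧
      (S.e ≫ S.i) ▷ S.Y ≫ m' = (λ_ _).hom ≫ i' ∧
      S.Y ◁ (S.e ≫ S.i) ≫ m' = (ρ_ _).hom ≫ i' ∧
      (∀ (M : Mon C) (f : S.Y ⟶ M.X), S.Compat M f →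
        ∃ f' : Z ⟶ M.X, i' ≫ f' = f ∧ m' ≫ f' = (f ⊗ₘ f) ≫ μ[M.X]) ∧
      (∀ (T : C) (p q : Z ⟶ T), i' ≫ p = i' ≫ q → m' ≫ p = m' ≫ q → p = q) := by
  let jl : S.Y ⟶ S.Y ⨿ (S.Y ⊗ S.Y) := coprod.inl
  let jr : S.Y ⊗ S.Y ⟶ S.Y ⨿ (S.Y ⊗ S.Y) := coprod.inr
  obtain ⟨Z, q, hq, hepi, hdesc⟩ := exists_coeq
    (coprod.desc (coprod.desc (S.m ≫ jl) ((S.m ⊗ₘ S.i) ≫ jr))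
      (coprod.desc ((S.e ≫ S.i) ▷ S.Y ≫ jr) (S.Y ◁ (S.e ≫ S.i) ≫ jr)))
    (coprod.desc (coprod.desc ((S.i ⊗ₘ S.i) ≫ jr) ((α_ _ _ _).hom ≫ (S.i ⊗ₘ S.m) ≫ jr))
      (coprod.desc ((λ_ _).hom ≫ jl) ((ρ_ _).hom ≫ jl)))
  simp only [coprod.desc_comp, Category.assoc] at hq
  obtain ⟨hq₁, hq₂⟩ := coprod_eq hq
  obtain ⟨hq₃, hq₄⟩ := coprod_eq hq₁
  obtain ⟨hq₅, hq₆⟩ := coprod_eq hq₂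
  refine ⟨Z, jl ≫ q, jr ≫ q, hq₃, hq₄, hq₅, hq₆, ?_, ?_⟩
  · rintro M f ⟨he, hm⟩
    obtain ⟨f', hf'⟩ := hdesc M.X (coprod.desc f ((f ⊗ₘ f) ≫ μ[M.X])) (by
      have hl : jl ≫ coprod.desc f ((f ⊗ₘ f) ≫ μ[M.X]) = f := coprod.inl_desc _ _
      have hr : jr ≫ coprod.desc f ((f ⊗ₘ f) ≫ μ[M.X]) = (f ⊗ₘ f) ≫ μ[M.X] :=
        coprod.inr_desc _ _
      have he' : (S.e ≫ S.i) ≫ f = η[M.X] := by rw [Category.assoc, he]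
      ext
      · simp only [coprod.inl_desc_assoc, Category.assoc, hl, hr]
        rw [tensorHom_comp_tensorHom_assoc, hm]
      · simp only [coprod.inl_desc_assoc, coprod.inr_desc_assoc, Category.assoc, hr]
        rw [tensorHom_comp_tensorHom_assoc, tensorHom_comp_tensorHom_assoc, hm, assoc_aux]
      · simp only [coprod.inl_desc_assoc, coprod.inr_desc_assoc, Category.assoc, hl, hr]
        exact one_aux M _ _ he'
      · simp only [coprod.inr_desc_assoc, Category.assoc, hl, hr]
        exact one_aux' M _ _ he')
    exact ⟨f', by rw [Category.assoc, hf']; exact coprod.inl_desc _ _,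
      by rw [Category.assoc, hf']; exact coprod.inr_desc _ _⟩
  · intro T p p' h1 h2
    rw [← cancel_epi q]
    exact coprod.hom_ext (by simpa using h1) (by simpa using h2)

lemma exists_init [HasColimits C] {J : Type v} [Category.{v} J] (D : J ⥤ Mon C) :
    ∃ (S : Stage C) (a : ∀ j, (D.obj j).X ⟶ S.X),
      (∀ {j k} (f : j ⟶ k), (D.map f).hom ≫ a k = a j) ∧
      (∀ j, η[(D.obj j).X] ≫ a j ≫ S.i = S.e ≫ S.i) ∧
      (∀ j, μ[(D.obj j).X] ≫ a j ≫ S.i = (a j ⊗ₘ a j) ≫ S.m) ∧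
      (∀ (c : Cocone D), ∃ f : S.Y ⟶ c.pt.X, S.Compat c.pt f ∧
        ∀ j, a j ≫ S.i ≫ f = (c.ι.app j).hom) ∧
      (∀ (T : C) (p q : S.X ⟶ T), (∀ j, a j ≫ p = a j ≫ q) → S.e ≫ p = S.e ≫ q → p = q) ∧
      (∀ (T : C) (p q : S.Y ⟶ T), S.i ≫ p = S.i ≫ q → S.m ≫ p = S.m ≫ q → p = q) := by
  let G := D ⋙ Mon.forget C
  let X : C := colimit G ⨿ 𝟙_ C
  let a : ∀ j, (D.obj j).X ⟶ X := fun j => colimit.ι G j ≫ coprod.inl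
  let e : 𝟙_ C ⟶ X := coprod.inr
  let jl : X ⟶ X ⨿ (X ⊗ X) := coprod.inl
  let jr : X ⊗ X ⟶ X ⨿ (X ⊗ X) := coprod.inr
  obtain ⟨Z, q, hq, hepi, hdesc⟩ := exists_coeq
    (coprod.desc (Sigma.desc fun j => η[(D.obj j).X] ≫ a j ≫ jl)
      (Sigma.desc fun j => μ[(D.obj j).X] ≫ a j ≫ jl))
    (coprod.desc (Sigma.desc fun j => e ≫ jl)
      (Sigma.desc fun j => (a j ⊗ₘ a j) ≫ jr))
  simp only [coprod.desc_comp] at hq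
  rw [sigma_comp, sigma_comp, sigma_comp, sigma_comp] at hq
  obtain ⟨hq₁, hq₂⟩ := coprod_eq hq
  refine ⟨⟨X, Z, e, jl ≫ q, jr ≫ q⟩, a, ?_, ?_, ?_, ?_, ?_, ?_⟩
  · intro j k f
    exact colimit.w_assoc G f _
  · intro j
    simpa only [Category.assoc] using sigma_eq hq₁ j
  · intro j
    simpa only [Category.assoc] using sigma_eq hq₂ j
  · intro c
    let g : X ⟶ c.pt.X := coprod.desc (colimit.desc G ((Mon.forget C).mapCocone c)) η[c.pt.X]
    have hag : ∀ j, a j ≫ g = (c.ι.app j).hom := by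
      intro j
      exact (Category.assoc _ _ _).trans
        ((congrArg (colimit.ι G j ≫ ·) (coprod.inl_desc _ _)).trans (colimit.ι_desc _ _))
    have heg : e ≫ g = η[c.pt.X] := coprod.inr_desc _ _
    have hl : jl ≫ coprod.desc g ((g ⊗ₘ g) ≫ μ[c.pt.X]) = g := coprod.inl_desc _ _
    have hr : jr ≫ coprod.desc g ((g ⊗ₘ g) ≫ μ[c.pt.X]) = (g ⊗ₘ g) ≫ μ[c.pt.X] :=
      coprod.inr_desc _ _
    obtain ⟨f, hf⟩ := hdesc c.pt.X (coprod.desc g ((g ⊗ₘ g) ≫ μ[c.pt.X])) (by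
      apply coprod.hom_ext <;> apply Sigma.hom_ext <;> intro j
      · simp only [coprod.inl_desc_assoc, Sigma.ι_desc_assoc, Category.assoc, hl, heg, hag]
        exact IsMonHom.one_hom _
      · simp only [coprod.inr_desc_assoc, Sigma.ι_desc_assoc, Category.assoc, hl, hr, hag]
        rw [tensorHom_comp_tensorHom_assoc, hag]
        exact IsMonHom.mul_hom _)
    have hg : (jl ≫ q) ≫ f = g := by rw [Category.assoc, hf, hl]
    refine ⟨f, ⟨?_, ?_⟩, ?_⟩
    · change e ≫ (jl ≫ q) ≫ f = _
      rw [hg, heg]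
    · change (jr ≫ q) ≫ f = (((jl ≫ q) ≫ f) ⊗ₘ ((jl ≫ q) ≫ f)) ≫ _
      rw [hg, Category.assoc, hf, hr]
    · intro j
      change a j ≫ (jl ≫ q) ≫ f = _
      rw [hg, hag]
  · intro T p p' h1 h2
    refine coprod.hom_ext (colimit.hom_ext fun j => ?_) h2
    exact (Category.assoc _ _ _).symm.trans ((h1 j).trans (Category.assoc _ _ _))
  · intro T p p' h1 h2
    rw [← cancel_epi q]
    exact coprod.hom_ext (by simpa using h1) (by simpa using h2)

/-- The tower approximating the colimit. -/
structure Tower {J : Type v} [Category.{v} J] (D : J ⥤ Mon C) where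
  X : ℕ → C
  e : ∀ n, 𝟙_ C ⟶ X n
  i : ∀ n, X n ⟶ X (n + 1)
  m : ∀ n, X n ⊗ X n ⟶ X (n + 1)
  a : ∀ j, (D.obj j).X ⟶ X 0
  he : ∀ n, e n ≫ i n = e (n + 1)
  a_nat : ∀ {j k} (f : j ⟶ k), (D.map f).hom ≫ a k = a j
  a_one : ∀ j, η[(D.obj j).X] ≫ a j ≫ i 0 = e 1
  a_mul : ∀ j, μ[(D.obj j).X] ≫ a j ≫ i 0 = (a j ⊗ₘ a j) ≫ m 0
  im : ∀ n, m n ≫ i (n + 1) = (i n ⊗ₘ i n) ≫ m (n + 1)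
  assoc : ∀ n, (m n ⊗ₘ i n) ≫ m (n + 1) = (α_ _ _ _).hom ≫ (i n ⊗ₘ m n) ≫ m (n + 1)
  one_m : ∀ n, e (n + 1) ▷ X (n + 1) ≫ m (n + 1) = (λ_ _).hom ≫ i (n + 1)
  m_one : ∀ n, X (n + 1) ◁ e (n + 1) ≫ m (n + 1) = (ρ_ _).hom ≫ i (n + 1)
  univ : ∀ c : Cocone D, ∃ f : ∀ n, X n ⟶ c.pt.X,
    (∀ j, a j ≫ f 0 = (c.ι.app j).hom) ∧ (e 0 ≫ f 0 = η[c.pt.X]) ∧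
    (∀ n, i n ≫ f (n + 1) = f n) ∧ (∀ n, m n ≫ f (n + 1) = (f n ⊗ₘ f n) ≫ μ[c.pt.X])
  ext0 : ∀ (T : C) (p q : X 0 ⟶ T), (∀ j, a j ≫ p = a j ≫ q) → e 0 ≫ p = e 0 ≫ q → p = q
  ext1 : ∀ n (T : C) (p q : X (n + 1) ⟶ T), i n ≫ p = i n ≫ q → m n ≫ p = m n ≫ q → p = q

lemma exists_tower [HasColimits C] {J : Type v} [Category.{v} J] (D : J ⥤ Mon C) :
    Nonempty (Tower D) := by
  obtain ⟨S₀, a, a_nat, a_one, a_mul, univ0, ext0, ext1⟩ := exists_init D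
  choose Z i' m' h1 h2 h3 h4 h5 h6 using exists_step (C := C)
  let S : ℕ → Stage C := fun n =>
    Nat.rec S₀ (fun _ T => ⟨T.Y, Z T, T.e ≫ T.i, i' T, m' T⟩) n
  refine ⟨{
    X := fun n => (S n).X
    e := fun n => (S n).e
    i := fun n => (S n).i
    m := fun n => (S n).m
    a := a
    he := fun n => rfl
    a_nat := a_nat
    a_one := a_one
    a_mul := a_mul
    im := fun n => h1 (S n)
    assoc := fun n => h2 (S n)
    one_m := fun n => h3 (S n)
    m_one := fun n => h4 (S n)
    univ := ?_
    ext0 := ext0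
    ext1 := fun n => ?_ }⟩
  · intro c
    obtain ⟨f₀, hf₀, haf⟩ := univ0 c
    have step : ∀ n (f : (S n).Y ⟶ c.pt.X), (S n).Compat c.pt f →
        ∃ f' : (S (n + 1)).Y ⟶ c.pt.X, (S (n + 1)).Compat c.pt f' ∧ (S (n + 1)).i ≫ f' = f := by
      intro n f hf
      obtain ⟨f', hi, hm⟩ := h5 (S n) c.pt f hf
      refine ⟨f', ⟨?_, ?_⟩, hi⟩
      · change ((S n).e ≫ (S n).i) ≫ i' (S n) ≫ f' = _
        rw [hi, Category.assoc, hf.1]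
      · change m' (S n) ≫ f' = ((i' (S n) ≫ f') ⊗ₘ (i' (S n) ≫ f')) ≫ _
        rw [hi, hm]
    choose nx hnx hnx' using step
    let F : ∀ n, { f : (S n).Y ⟶ c.pt.X // (S n).Compat c.pt f } := fun n =>
      Nat.rec ⟨f₀, hf₀⟩ (fun n f => ⟨nx n f.1 f.2, hnx n f.1 f.2⟩) n
    refine ⟨fun n => (S n).i ≫ (F n).1, haf, hf₀.1, fun n => ?_, fun n => ?_⟩
    · exact congrArg ((S n).i ≫ ·) (hnx' n (F n).1 (F n).2)
    · exact (congrArg ((S n).m ≫ ·) (hnx' n (F n).1 (F n).2)).trans (F n).2.2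
  · cases n with
    | zero => exact ext1
    | succ n => exact h6 (S n)

lemma preserves_nat {F : C ⥤ C} (h : PreservesFilteredColimits F) :
    PreservesColimitsOfShape ℕ F := by
  let E : ULiftHom.{v} (ULift.{v} ℕ) ≌ ℕ := (ULiftHomULiftCategory.equiv.{v, v} ℕ).symm
  have : IsFiltered (ULiftHom.{v} (ULift.{v} ℕ)) := IsFiltered.of_equivalence E.symm
  have := h.preserves_filtered_colimits (ULiftHom.{v} (ULift.{v} ℕ))
  exact preservesColimitsOfShape_of_equiv E F

lemma hasColimit_nat [HasColimits C] : HasColimitsOfShape ℕ C := by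
  let E : ULiftHom.{v} (ULift.{v} ℕ) ≌ ℕ := (ULiftHomULiftCategory.equiv.{v, v} ℕ).symm
  exact hasColimitsOfShape_of_equivalence E

lemma exists_telescope [HasColimits C]
    (h₁ : ∀ X : C, PreservesFilteredColimits (tensorLeft X))
    (h₂ : ∀ X : C, PreservesFilteredColimits (tensorRight X))
    (X : ℕ → C) (i : ∀ n, X n ⟶ X (n + 1)) :
    ∃ (W : C) (w : ∀ n, X n ⟶ W), (∀ n, i n ≫ w (n + 1) = w n) ∧
      (∀ (T : C) (f : ∀ n, X n ⟶ T), (∀ n, i n ≫ f (n + 1) = f n) →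
        ∃ g : W ⟶ T, ∀ n, w n ≫ g = f n) ∧
      (∀ (T : C) (p q : W ⟶ T), (∀ n, w n ≫ p = w n ≫ q) → p = q) ∧
      (∀ (T : C) (f : ∀ n, X n ⊗ X n ⟶ T), (∀ n, (i n ⊗ₘ i n) ≫ f (n + 1) = f n) →
        ∃ g : W ⊗ W ⟶ T, ∀ n, (w n ⊗ₘ w n) ≫ g = f n) ∧
      (∀ (T : C) (p q : W ⊗ W ⟶ T), (∀ n, (w n ⊗ₘ w n) ≫ p = (w n ⊗ₘ w n) ≫ q) → p = q) ∧
      (∀ (T : C) (p q : (W ⊗ W) ⊗ W ⟶ T),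
        (∀ n, ((w n ⊗ₘ w n) ⊗ₘ w n) ≫ p = ((w n ⊗ₘ w n) ⊗ₘ w n) ≫ q) → p = q) := by
  have : HasColimitsOfShape ℕ C := hasColimit_nat
  have hl : ∀ X : C, PreservesColimitsOfShape ℕ ((curriedTensor C).obj X) :=
    fun X => preserves_nat (h₁ X)
  have hr : ∀ X : C, PreservesColimitsOfShape ℕ ((curriedTensor C).flip.obj X) :=
    fun X => preserves_nat (h₂ X)
  let F : ℕ ⥤ C := Functor.ofSequence i
  have hF : ∀ n, F.map (homOfLE (Nat.le_add_right n 1)) = i n :=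
    Functor.ofSequence_map_homOfLE_succ i
  let c := colimit.cocone F
  let hc : IsColimit c := colimit.isColimit F
  let hcc : IsColimit (c.tensor c) := hc.tensor hc
  let hccc : IsColimit ((c.tensor c).tensor c) := hcc.tensor hc
  refine ⟨c.pt, fun n => c.ι.app n, ?_, ?_, ?_, ?_, ?_, ?_⟩
  · intro n
    rw [← hF n]
    exact c.w _
  · intro T f hf
    let s : Cocone F := ⟨T, NatTrans.ofSequence f (fun n => by
      rw [hF]; exact (hf n).trans (Category.comp_id _).symm)⟩
    exact ⟨hc.desc s, fun n => hc.fac s n⟩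
  · intro T p q h
    exact hc.hom_ext h
  · intro T f hf
    let s : Cocone (F ⊗ F) := ⟨T, NatTrans.ofSequence f (fun n => by
      change (F.map _ ⊗ₘ F.map _) ≫ _ = _
      rw [hF]; exact (hf n).trans (Category.comp_id _).symm)⟩
    exact ⟨hcc.desc s, fun n => hcc.fac s n⟩
  · intro T p q h
    exact hcc.hom_ext h
  · intro T p q h
    exact hccc.hom_ext h

lemma hasColimit_mon [HasColimits C]
    (h₁ : ∀ X : C, PreservesFilteredColimits (tensorLeft X))
    (h₂ : ∀ X : C, PreservesFilteredColimits (tensorRight X))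
    {J : Type v} [Category.{v} J] (D : J ⥤ Mon C) : HasColimit D := by
  obtain ⟨t⟩ := exists_tower D
  obtain ⟨W, w, hw, desc1, ext1, desc2, ext2, ext3⟩ := exists_telescope h₁ h₂ t.X t.i
  obtain ⟨mu, hmu⟩ := desc2 W (fun n => t.m n ≫ w (n + 1)) (fun n => by
    rw [← Category.assoc, ← t.im, Category.assoc, hw])
  have hew : ∀ n, t.e n ≫ w n = t.e 0 ≫ w 0 := by
    intro n
    induction n with
    | zero => rfl
    | succ n ih => rw [← t.he, Category.assoc, hw, ih]
  letI : MonObj W :=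
    { one := t.e 0 ≫ w 0
      mul := mu
      one_mul := by
        rw [← cancel_epi (λ_ W).inv, Iso.inv_hom_id]
        apply ext1
        intro n
        rw [← hw n, Category.assoc, Category.assoc, ← hew (n + 1), Category.comp_id]
        congr 1
        rw [leftUnitor_inv_naturality_assoc, Iso.inv_comp_eq]
        have h := t.one_m n =≫ w (n + 1 + 1)
        rw [Category.assoc, Category.assoc, hw, ← hmu] at h
        rw [← h, ← id_tensorHom, ← tensorHom_id, tensorHom_comp_tensorHom_assoc,
          ← tensorHom_id, tensorHom_comp_tensorHom_assoc]
        simp only [Category.id_comp, Category.comp_id]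
      mul_one := by
        rw [← cancel_epi (ρ_ W).inv, Iso.inv_hom_id]
        apply ext1
        intro n
        rw [← hw n, Category.assoc, Category.assoc, ← hew (n + 1), Category.comp_id]
        congr 1
        rw [rightUnitor_inv_naturality_assoc, Iso.inv_comp_eq]
        have h := t.m_one n =≫ w (n + 1 + 1)
        rw [Category.assoc, Category.assoc, hw, ← hmu] at h
        rw [← h, ← id_tensorHom, ← tensorHom_id, tensorHom_comp_tensorHom_assoc,
          ← id_tensorHom, tensorHom_comp_tensorHom_assoc]
        simp only [Category.id_comp, Category.comp_id]
      mul_assoc := by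
        apply ext3
        intro n
        rw [associator_naturality_assoc, ← id_tensorHom, ← tensorHom_id,
          tensorHom_comp_tensorHom_assoc, tensorHom_comp_tensorHom_assoc, hmu,
          Category.comp_id, ← hw n, ← tensorHom_comp_tensorHom_assoc,
          ← tensorHom_comp_tensorHom_assoc, hmu, ← Category.assoc, t.assoc]
        simp only [Category.assoc] }
  let c : Cocone D :=
    ⟨Mon.mk W,
        { app := fun j =>
            { hom := t.a j ≫ w 0
              isMonHom_hom :=
                { one_hom := by
                    change _ = t.e 0 ≫ w 0
                    rw [← hw 0, ← Category.assoc (t.a j), ← Category.assoc, t.a_one, hew 1, hw 0]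
                  mul_hom := by
                    change _ = _ ≫ mu
                    rw [← tensorHom_comp_tensorHom_assoc, hmu, ← hw 0, ← Category.assoc (t.a j),
                      ← Category.assoc, t.a_mul, Category.assoc] } }
          naturality := by
            intro j k f
            ext
            change (D.map f).hom ≫ t.a k ≫ w 0 = (t.a j ≫ w 0) ≫ 𝟙 _
            rw [← Category.assoc, t.a_nat, Category.comp_id] }⟩
  have hdesc : ∀ s : Cocone D, ∃ g : c.pt ⟶ s.pt, ∀ j, c.ι.app j ≫ g = s.ι.app j := by
    intro s
    obtain ⟨f, hf1, hf2, hf3, hf4⟩ := t.univ s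
    obtain ⟨g, hg⟩ := desc1 _ f hf3
    refine ⟨{ hom := g, isMonHom_hom := { one_hom := ?_, mul_hom := ?_ } }, ?_⟩
    · change (t.e 0 ≫ w 0) ≫ g = _
      rw [Category.assoc, hg, hf2]
    · apply ext2
      intro n
      change _ ≫ mu ≫ g = _
      rw [← Category.assoc, hmu, Category.assoc, hg, hf4, tensorHom_comp_tensorHom_assoc, hg]
    · intro j
      ext
      change (t.a j ≫ w 0) ≫ g = _
      rw [Category.assoc, hg, hf1]
  have huniq : ∀ (T : Mon C) (p q : c.pt ⟶ T), (∀ j, c.ι.app j ≫ p = c.ι.app j ≫ q) → p = q := by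
    intro T p q h
    ext
    apply ext1
    intro n
    induction n with
    | zero =>
      apply t.ext0
      · intro j
        have := congrArg Mon.Hom.hom (h j)
        change (t.a j ≫ w 0) ≫ p.hom = (t.a j ≫ w 0) ≫ q.hom at this
        simpa only [Category.assoc] using this
      · have h1 : (t.e 0 ≫ w 0) ≫ p.hom = η[T.X] := IsMonHom.one_hom p.hom
        have h2 : (t.e 0 ≫ w 0) ≫ q.hom = η[T.X] := IsMonHom.one_hom q.hom
        rw [← Category.assoc, ← Category.assoc, h1, h2]
    | succ n ih =>
      apply t.ext1
      · rw [← Category.assoc, ← Category.assoc, hw, ih]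
      · have h1 : mu ≫ p.hom = (p.hom ⊗ₘ p.hom) ≫ μ[T.X] := IsMonHom.mul_hom p.hom
        have h2 : mu ≫ q.hom = (q.hom ⊗ₘ q.hom) ≫ μ[T.X] := IsMonHom.mul_hom q.hom
        rw [← Category.assoc, ← Category.assoc, ← hmu, Category.assoc, Category.assoc, h1, h2]
        have := congrArg (fun x => (x ⊗ₘ x) ≫ μ[T.X]) ih
        simp only [← tensorHom_comp_tensorHom, Category.assoc] at this
        exact this
  choose d hd using hdesc
  have hu : ∀ (s : Cocone D) (m : c.pt ⟶ s.pt), (∀ j, c.ι.app j ≫ m = s.ι.app j) → m = d s :=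
    fun s m hm => huniq _ _ _ (fun j => (hm j).trans (hd s j).symm)
  exact ⟨⟨⟨c, ⟨d, hd, hu⟩⟩⟩⟩

end Stmt6Aux

/-- If `C` is a complete and cocomplete monoidal category in which tensoring on
either side preserves filtered colimits, then the category `Mon_ C` of monoid
objects in `C` is cocomplete. -/
theorem stmt6 {C : Type u} [Category.{v} C] [MonoidalCategory C]
    [HasLimits C] [HasColimits C]
    (h₁ : ∀ X : C, PreservesFilteredColimits (tensorLeft X))
    (h₂ : ∀ X : C, PreservesFilteredColimits (tensorRight X)) :
    HasColimits (Mon C) := by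
  exact ⟨fun _ _ => ⟨fun D => Stmt6Aux.hasColimit_mon h₁ h₂ D⟩⟩
end

section
/- Let C be a monoidal category which is complete and cocomplete such that for every object X of C the functors X ⊗ (−) and (−) ⊗ X preserve filtered colimits. Let B be a monoidal category and let L : B ⇄ C : R be an adjunction (L the left adjoint) in which R is lax monoidal. Then the induced functor Mon(C) → Mon(B), sending a monoid A in C to R(A) with the monoid structure R(A) ⊗ R(A) → R(A ⊗ A) → R(A), 1 → R(1) → R(A) coming from the lax monoidal structure, admits a left adjoint. -/
open CategoryTheory CategoryTheory.Limits CategoryTheory.MonoidalCategory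

universe v₁ v₂ u₁ u₂

namespace Aux

section Seq
variable {C : Type u₂} [Category.{v₂} C]

structure IsSeq (X : ℕ → C) (j : ∀ n, X n ⟶ X (n+1)) (A : C) (i : ∀ n, X n ⟶ A) : Prop where
  w : ∀ n, j n ≫ i (n+1) = i n
  desc : ∀ (M : C) (p : ∀ n, X n ⟶ M), (∀ n, j n ≫ p (n+1) = p n) → ∃ r : A ⟶ M, ∀ n, i n ≫ r = p n
  ext : ∀ (M : C) (f g : A ⟶ M), (∀ n, i n ≫ f = i n ≫ g) → f = g

def seqCocone (F : ℕ ⥤ C) (A : C) (i : ∀ n, F.obj n ⟶ A)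
    (w : ∀ n, F.map (homOfLE (Nat.le_add_right n 1)) ≫ i (n+1) = i n) : Cocone F where
  pt := A
  ι := NatTrans.ofSequence i (by intro n; rw [w n]; simp)

lemma IsSeq.nonempty_isColimit {X : ℕ → C} {j : ∀ n, X n ⟶ X (n+1)} {A : C} {i : ∀ n, X n ⟶ A}
    (h : IsSeq X j A i) : Nonempty (IsColimit (seqCocone (Functor.ofSequence j) A i
      (by intro n; rw [Functor.ofSequence_map_homOfLE_succ]; exact h.w n))) := by
  have key : ∀ s : Cocone (Functor.ofSequence j), ∃ r : A ⟶ s.pt, ∀ n, i n ≫ r = s.ι.app n := by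
    intro s
    apply h.desc
    intro n
    have := s.w (homOfLE (Nat.le_add_right n 1))
    rwa [Functor.ofSequence_map_homOfLE_succ] at this
  choose r hr using key
  exact ⟨{ desc := r
           fac := hr
           uniq := fun s m hm => h.ext _ _ _ (fun n => (hm n).trans (hr s n).symm) }⟩

lemma IsSeq.of_isColimit (F : ℕ ⥤ C) (c : Cocone F) (hc : IsColimit c) :
    IsSeq F.obj (fun n => F.map (homOfLE (Nat.le_add_right n 1))) c.pt c.ι.app where
  w n := c.w _
  desc M p hp := ⟨hc.desc (seqCocone F M p hp), fun n => hc.fac (seqCocone F M p hp) n⟩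
  ext M f g h := hc.hom_ext h

lemma IsSeq.congr {X : ℕ → C} {j j' : ∀ n, X n ⟶ X (n+1)} {A : C} {i i' : ∀ n, X n ⟶ A}
    (h : IsSeq X j A i) (hj : ∀ n, j n = j' n) (hi : ∀ n, i n = i' n) : IsSeq X j' A i' := by
  obtain rfl : j = j' := funext hj
  obtain rfl : i = i' := funext hi
  exact h

lemma IsSeq.ext_succ {X : ℕ → C} {j : ∀ n, X n ⟶ X (n+1)} {A : C} {i : ∀ n, X n ⟶ A}
    (h : IsSeq X j A i) (M : C) (f g : A ⟶ M) (e : ∀ n, i (n+1) ≫ f = i (n+1) ≫ g) : f = g :=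
  h.ext _ _ _ fun n => by rw [← h.w, Category.assoc, Category.assoc, e]

lemma exists_isSeq [HasColimits C] (X : ℕ → C) (j : ∀ n, X n ⟶ X (n+1)) :
    ∃ A i, IsSeq X j A i := by
  have : HasColimitsOfSize.{0,0} C := hasColimitsOfSizeShrink.{0,0,v₂,v₂} C
  have := IsSeq.of_isColimit _ _ (colimit.isColimit (Functor.ofSequence j))
  simp only [Functor.ofSequence_map_homOfLE_succ] at this
  exact ⟨_, _, this⟩

lemma IsSeq.tensor [MonoidalCategory C] (h₁ : ∀ X : C, PreservesFilteredColimits (tensorLeft X))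
    (h₂ : ∀ X : C, PreservesFilteredColimits (tensorRight X))
    {X : ℕ → C} {j : ∀ n, X n ⟶ X (n+1)} {A : C} {i : ∀ n, X n ⟶ A}
    {X' : ℕ → C} {j' : ∀ n, X' n ⟶ X' (n+1)} {A' : C} {i' : ∀ n, X' n ⟶ A'}
    (h : IsSeq X j A i) (h' : IsSeq X' j' A' i') :
    IsSeq (fun n => X n ⊗ X' n) (fun n => j n ⊗ₘ j' n) (A ⊗ A') (fun n => i n ⊗ₘ i' n) := by
  obtain ⟨c⟩ := h.nonempty_isColimit
  obtain ⟨c'⟩ := h'.nonempty_isColimit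
  have : ∀ X : C, PreservesFilteredColimitsOfSize.{0,0} ((curriedTensor C).obj X) := fun X =>
    have := h₁ X
    preservesFilteredColimitsOfSize_shrink.{0,v₂,0,v₂} (tensorLeft X)
  have : ∀ X : C, PreservesFilteredColimitsOfSize.{0,0} ((curriedTensor C).flip.obj X) := fun X =>
    have := h₂ X
    preservesFilteredColimitsOfSize_shrink.{0,v₂,0,v₂} (tensorRight X)
  have hc := isColimitOfPreserves₂ (curriedTensor C) c c'
  have hd := (Functor.Final.isColimitWhiskerEquiv (Functor.diag ℕ) _).symm hc
  exact (IsSeq.of_isColimit _ _ hd).congr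
    (fun n => by
      refine Eq.trans ?_ (congrArg₂ (fun a b => a ⊗ₘ b) (Functor.ofSequence_map_homOfLE_succ j n)
        (Functor.ofSequence_map_homOfLE_succ j' n))
      exact (MonoidalCategory.tensorHom_def _ _).symm)
    (fun n => (MonoidalCategory.tensorHom_def _ _).symm)

end Seq

section Quot
variable {C : Type u₂} [Category.{v₂} C]

lemma exists_quot [HasColimits C] {k : ℕ} (W : C) (t : Fin k → Σ K : C, (K ⟶ W) × (K ⟶ W)) :
    ∃ (Q : C) (q : W ⟶ Q), (∀ i, (t i).2.1 ≫ q = (t i).2.2 ≫ q) ∧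
      (∀ (M : C) (g : W ⟶ M), (∀ i, (t i).2.1 ≫ g = (t i).2.2 ≫ g) → ∃ r, q ≫ r = g) ∧ Epi q := by
  refine ⟨coequalizer (Sigma.desc fun i => (t i).2.1) (Sigma.desc fun i => (t i).2.2),
    coequalizer.π _ _, fun i => ?_, fun M g hg => ?_, inferInstance⟩
  · have := congrArg (fun u => Sigma.ι (fun i => (t i).1) i ≫ u)
      (coequalizer.condition (Sigma.desc fun i => (t i).2.1) (Sigma.desc fun i => (t i).2.2))
    simpa using this
  · exact ⟨coequalizer.desc g (by
      apply Sigma.hom_ext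
      intro i
      simpa using hg i), coequalizer.π_desc _ _⟩

end Quot

lemma exists_monObj {C : Type u₂} [Category.{v₂} C] [MonoidalCategory C]
    (h₁ : ∀ X : C, PreservesFilteredColimits (tensorLeft X))
    (h₂ : ∀ X : C, PreservesFilteredColimits (tensorRight X))
    {X : ℕ → C} {j : ∀ n, X n ⟶ X (n+1)} {A : C} {i : ∀ n, X n ⟶ A} (hA : IsSeq X j A i)
    (mm : ∀ n, X n ⊗ X n ⟶ X (n+1)) (e : ∀ n, 𝟙_ C ⟶ X n)
    (he : ∀ n, e (n+1) = e n ≫ j n)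
    (hcompat : ∀ n, mm n ≫ j (n+1) = (j n ⊗ₘ j n) ≫ mm (n+1))
    (hassoc : ∀ n, (mm n ⊗ₘ j n) ≫ mm (n+1) = (α_ _ _ _).hom ≫ (j n ⊗ₘ mm n) ≫ mm (n+1))
    (hone : ∀ n, (e (n+1) ⊗ₘ 𝟙 (X (n+1))) ≫ mm (n+1) = (λ_ _).hom ≫ j (n+1))
    (hone' : ∀ n, (𝟙 (X (n+1)) ⊗ₘ e (n+1)) ≫ mm (n+1) = (ρ_ _).hom ≫ j (n+1)) :
    ∃ _ : MonObj A, (∀ n, e n ≫ i n = MonObj.one) ∧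
      (∀ n, (i n ⊗ₘ i n) ≫ MonObj.mul = mm n ≫ i (n+1)) := by
  have hA2 := hA.tensor h₁ h₂ hA
  have hA3 := hA2.tensor h₁ h₂ hA
  obtain ⟨mA, hmA⟩ := hA2.desc A (fun n => mm n ≫ i (n+1)) (fun n => by
    rw [← Category.assoc, ← hcompat, Category.assoc, hA.w])
  have heA : ∀ n, e n ≫ i n = e 0 ≫ i 0 := by
    intro n
    induction n with
    | zero => rfl
    | succ n ih => rw [he, Category.assoc, hA.w, ih]
  letI : MonObj A :=
    { one := e 0 ≫ i 0
      mul := mA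
      one_mul := by
        rw [← cancel_epi (λ_ A).inv, Iso.inv_hom_id]
        apply hA.ext_succ
        intro n
        rw [leftUnitor_inv_naturality_assoc, ← heA (n+1), ← MonoidalCategory.tensorHom_id,
          ← MonoidalCategory.id_tensorHom, MonoidalCategory.tensorHom_comp_tensorHom_assoc,
          Category.id_comp, Category.comp_id]
        rw [show (e (n+1) ≫ i (n+1) ⊗ₘ i (n+1)) =
          (e (n+1) ⊗ₘ 𝟙 _) ≫ (i (n+1) ⊗ₘ i (n+1)) by
            rw [MonoidalCategory.tensorHom_comp_tensorHom, Category.id_comp], Category.assoc, hmA,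
          ← Category.assoc (e (n+1) ⊗ₘ 𝟙 _), hone, Category.assoc, Iso.inv_hom_id_assoc, hA.w]
      mul_one := by
        rw [← cancel_epi (ρ_ A).inv, Iso.inv_hom_id]
        apply hA.ext_succ
        intro n
        rw [rightUnitor_inv_naturality_assoc, ← heA (n+1), ← MonoidalCategory.tensorHom_id,
          ← MonoidalCategory.id_tensorHom, MonoidalCategory.tensorHom_comp_tensorHom_assoc,
          Category.id_comp, Category.comp_id]
        rw [show (i (n+1) ⊗ₘ e (n+1) ≫ i (n+1)) =
          (𝟙 _ ⊗ₘ e (n+1)) ≫ (i (n+1) ⊗ₘ i (n+1)) by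
            rw [MonoidalCategory.tensorHom_comp_tensorHom, Category.id_comp], Category.assoc, hmA,
          ← Category.assoc (𝟙 _ ⊗ₘ e (n+1)), hone', Category.assoc, Iso.inv_hom_id_assoc, hA.w]
      mul_assoc := by
        apply hA3.ext
        intro n
        rw [← MonoidalCategory.tensorHom_id, ← MonoidalCategory.id_tensorHom,
          MonoidalCategory.associator_naturality_assoc,
          MonoidalCategory.tensorHom_comp_tensorHom_assoc,
          MonoidalCategory.tensorHom_comp_tensorHom_assoc, hmA, Category.comp_id, ← hA.w n,
          ← MonoidalCategory.tensorHom_comp_tensorHom_assoc, hmA,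
          ← MonoidalCategory.tensorHom_comp_tensorHom_assoc, hmA, ← Category.assoc, hassoc]
        simp only [Category.assoc] }
  exact ⟨this, heA, hmA⟩

section Stage
open Functor.LaxMonoidal
variable {B : Type u₁} {C : Type u₂} [Category.{v₁} B] [Category.{v₂} C]
    [MonoidalCategory B] [MonoidalCategory C]

structure Stage (R : C ⥤ B) (N : Mon B) where
  X : C
  Y : C
  j : X ⟶ Y
  m : X ⊗ X ⟶ Y
  e : 𝟙_ C ⟶ X
  f : N.X ⟶ R.obj X

variable {R : C ⥤ B} [R.LaxMonoidal] {N : Mon B}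

structure Good (s : Stage R N) {Z : C} (z : s.Y ⟶ Z) (m : s.Y ⊗ s.Y ⟶ Z) : Prop where
  compat : s.m ≫ z = (s.j ⊗ₘ s.j) ≫ m
  assoc : (s.m ⊗ₘ s.j) ≫ m = (α_ _ _ _).hom ≫ (s.j ⊗ₘ s.m) ≫ m
  one_mul : ((s.e ≫ s.j) ⊗ₘ 𝟙 s.Y) ≫ m = (λ_ _).hom ≫ z
  mul_one : (𝟙 s.Y ⊗ₘ (s.e ≫ s.j)) ≫ m = (ρ_ _).hom ≫ z
  fmul : MonObj.mul ≫ s.f ≫ R.map (s.j ≫ z) = (s.f ⊗ₘ s.f) ≫ μ R _ _ ≫ R.map (s.m ≫ z)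
  fone : MonObj.one ≫ s.f ≫ R.map (s.j ≫ z) = ε R ≫ R.map (s.e ≫ s.j ≫ z)

lemma exists_next [HasColimits C] {L : B ⥤ C} (adj : L ⊣ R) (s : Stage R N) :
    ∃ (Z : C) (z : s.Y ⟶ Z) (m : s.Y ⊗ s.Y ⟶ Z), Good s z m ∧
      (∀ (M : C) (z' : s.Y ⟶ M) (m' : s.Y ⊗ s.Y ⟶ M), Good s z' m' →
        ∃ r : Z ⟶ M, z ≫ r = z' ∧ m ≫ r = m') ∧
      (∀ (M : C) (r r' : Z ⟶ M), z ≫ r = z ≫ r' → m ≫ r = m ≫ r' → r = r') := by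
  let il : s.Y ⟶ s.Y ⨿ (s.Y ⊗ s.Y) := coprod.inl
  let ir : s.Y ⊗ s.Y ⟶ s.Y ⨿ (s.Y ⊗ s.Y) := coprod.inr
  let t : Fin 6 → Σ K : C, (K ⟶ s.Y ⨿ (s.Y ⊗ s.Y)) × (K ⟶ s.Y ⨿ (s.Y ⊗ s.Y)) :=
    ![⟨_, s.m ≫ il, (s.j ⊗ₘ s.j) ≫ ir⟩,
      ⟨_, (s.m ⊗ₘ s.j) ≫ ir, (α_ _ _ _).hom ≫ (s.j ⊗ₘ s.m) ≫ ir⟩,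
      ⟨_, ((s.e ≫ s.j) ⊗ₘ 𝟙 s.Y) ≫ ir, (λ_ _).hom ≫ il⟩,
      ⟨_, (𝟙 s.Y ⊗ₘ (s.e ≫ s.j)) ≫ ir, (ρ_ _).hom ≫ il⟩,
      ⟨_, (adj.homEquiv _ _).symm (MonObj.mul ≫ s.f ≫ R.map (s.j ≫ il)),
        (adj.homEquiv _ _).symm ((s.f ⊗ₘ s.f) ≫ μ R _ _ ≫ R.map (s.m ≫ il))⟩,
      ⟨_, (adj.homEquiv _ _).symm (MonObj.one ≫ s.f ≫ R.map (s.j ≫ il)),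
        (adj.homEquiv _ _).symm (ε R ≫ R.map (s.e ≫ s.j ≫ il))⟩]
  have key : ∀ {M : C} (g : s.Y ⨿ (s.Y ⊗ s.Y) ⟶ M),
      (∀ i, (t i).2.1 ≫ g = (t i).2.2 ≫ g) ↔ Good s (il ≫ g) (ir ≫ g) := by
    intro M g
    have e5 : ∀ {K : B} (a b : K ⟶ R.obj (s.Y ⨿ (s.Y ⊗ s.Y))),
        (adj.homEquiv _ _).symm a ≫ g = (adj.homEquiv _ _).symm b ≫ g ↔
          a ≫ R.map g = b ≫ R.map g := by
      intro K a b
      rw [← adj.homEquiv_naturality_right_symm, ← adj.homEquiv_naturality_right_symm]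
      exact (adj.homEquiv _ _).symm.injective.eq_iff
    constructor
    · intro h
      have h0 := h 0
      have h1 := h 1
      have h2 := h 2
      have h3 := h 3
      have h4 := (e5 _ _).1 (h 4)
      have h5 := (e5 _ _).1 (h 5)
      simp only [t, Category.assoc, Matrix.cons_val, R.map_comp] at h0 h1 h2 h3 h4 h5
      refine ⟨h0, h1, h2, h3, ?_, ?_⟩
      · simpa only [Category.assoc, R.map_comp] using h4
      · simpa only [Category.assoc, R.map_comp] using h5
    · intro h i
      fin_cases i
      · simpa [t] using h.compat
      · have h' := h.assoc
        have e1 : ((s.m ⊗ₘ s.j) ≫ ir) ≫ g =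
            ((α_ _ _ _).hom ≫ (s.j ⊗ₘ s.m) ≫ ir) ≫ g := by
          simpa only [Category.assoc] using h'
        exact e1
      · have h' := h.one_mul
        simp only [← Category.assoc] at h'
        exact h'
      · have h' := h.mul_one
        simp only [← Category.assoc] at h'
        exact h'
      · refine (e5 _ _).2 ?_
        simpa only [Category.assoc, R.map_comp] using h.fmul
      · refine (e5 _ _).2 ?_
        simpa only [Category.assoc, R.map_comp] using h.fone
  obtain ⟨Z, q, hq, hd, he⟩ := exists_quot _ t
  refine ⟨Z, il ≫ q, ir ≫ q, (key q).1 hq, fun M z' m' h => ?_, fun M r r' h h' => ?_⟩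
  · obtain ⟨r, hr⟩ := hd M (coprod.desc z' m') ((key _).2 (by
      rw [coprod.inl_desc, coprod.inr_desc]; exact h))
    exact ⟨r, by rw [Category.assoc, hr, coprod.inl_desc], by rw [Category.assoc, hr, coprod.inr_desc]⟩
  · rw [← cancel_epi q]
    apply coprod.hom_ext
    · simpa [il] using h
    · simpa [ir] using h'

structure SHom (s : Stage R N) (M : Mon C) (g : N.X ⟶ R.obj M.X) (p : s.X ⟶ M.X) (q : s.Y ⟶ M.X) :
    Prop where
  hj : s.j ≫ q = p
  hm : s.m ≫ q = (p ⊗ₘ p) ≫ MonObj.mul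
  he : s.e ≫ p = MonObj.one
  hf : s.f ≫ R.map p = g

lemma SHom.good {s : Stage R N} {M : Mon C} {g : N.X ⟶ R.obj M.X}
    {p : s.X ⟶ M.X} {q : s.Y ⟶ M.X} (h : SHom s M g p q)
    (g1 : MonObj.one ≫ g = ε R ≫ R.map MonObj.one)
    (g2 : MonObj.mul ≫ g = (g ⊗ₘ g) ≫ μ R _ _ ≫ R.map MonObj.mul) :
    Good s q ((q ⊗ₘ q) ≫ MonObj.mul) where
  compat := by
    rw [h.hm, MonoidalCategory.tensorHom_comp_tensorHom_assoc, h.hj]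
  assoc := by
    rw [MonoidalCategory.tensorHom_comp_tensorHom_assoc,
      MonoidalCategory.tensorHom_comp_tensorHom_assoc, h.hm, h.hj]
    have := MonObj.mul_assoc M.X
    have := congrArg (fun u => ((p ⊗ₘ p) ⊗ₘ p) ≫ u) this
    simp only [← MonoidalCategory.tensorHom_id, ← MonoidalCategory.id_tensorHom] at this
    rw [MonoidalCategory.associator_naturality_assoc,
      MonoidalCategory.tensorHom_comp_tensorHom_assoc,
      MonoidalCategory.tensorHom_comp_tensorHom_assoc, Category.comp_id] at this
    exact this
  one_mul := by
    rw [MonoidalCategory.tensorHom_comp_tensorHom_assoc, Category.assoc, h.hj, h.he,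
      Category.id_comp, MonObj.one_mul_hom]
  mul_one := by
    rw [MonoidalCategory.tensorHom_comp_tensorHom_assoc, Category.assoc, h.hj, h.he,
      Category.id_comp, MonObj.mul_one_hom]
  fmul := by
    rw [h.hj, h.hf, h.hm, g2, R.map_comp, ← μ_natural_assoc,
      MonoidalCategory.tensorHom_comp_tensorHom_assoc, h.hf]
  fone := by
    rw [h.hj, h.hf, h.he, g1]

lemma exists_init [HasColimits C] {L : B ⥤ C} (adj : L ⊣ R) :
    ∃ s : Stage R N, (∀ (M : Mon C) (g : N.X ⟶ R.obj M.X), ∃ p q, SHom s M g p q) ∧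
      (∀ (M : Mon C) (g : N.X ⟶ R.obj M.X) (p q p' q'), SHom s M g p q → SHom s M g p' q' →
        p = p' ∧ q = q') := by
  let X : C := 𝟙_ C ⨿ L.obj N.X
  refine ⟨⟨X, X ⨿ (X ⊗ X), coprod.inl, coprod.inr, coprod.inl,
    (adj.homEquiv _ _) coprod.inr⟩, fun M g => ?_, fun M g p q p' q' h h' => ?_⟩
  · let p : X ⟶ M.X := coprod.desc MonObj.one ((adj.homEquiv _ _).symm g)
    refine ⟨p, coprod.desc p ((p ⊗ₘ p) ≫ MonObj.mul), ⟨coprod.inl_desc _ _, coprod.inr_desc _ _,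
      coprod.inl_desc _ _, ?_⟩⟩
    dsimp only
    rw [← adj.homEquiv_naturality_right, coprod.inr_desc, Equiv.apply_symm_apply]
  · have hp : p = p' := by
      apply coprod.hom_ext
      · exact h.he.trans h'.he.symm
      · have := h.hf.trans h'.hf.symm
        dsimp only at this
        rw [← adj.homEquiv_naturality_right, ← adj.homEquiv_naturality_right] at this
        exact (adj.homEquiv _ _).injective this
    subst hp
    refine ⟨rfl, ?_⟩
    apply coprod.hom_ext
    · exact h.hj.trans h'.hj.symm
    · exact h.hm.trans h'.hm.symm


lemma main [HasColimits C] (h₁ : ∀ X : C, PreservesFilteredColimits (tensorLeft X))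
    (h₂ : ∀ X : C, PreservesFilteredColimits (tensorRight X)) {L : B ⥤ C} (adj : L ⊣ R) (N : Mon B) :
    HasInitial (StructuredArrow N (R.mapMon : Mon C ⥤ Mon B)) := by
  obtain ⟨s₀, hs₀, hs₀'⟩ := exists_init (N := N) adj
  choose Z z m hgood hdesc hext using exists_next (N := N) adj
  let S : ℕ → Stage R N := fun n => Nat.rec s₀
    (fun _ s => ⟨s.Y, Z s, z s, m s, s.e ≫ s.j, s.f ≫ R.map s.j⟩) n
  let X : ℕ → C := fun n => (S n).X
  let j : ∀ n, X n ⟶ X (n+1) := fun n => (S n).j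
  let mm : ∀ n, X n ⊗ X n ⟶ X (n+1) := fun n => (S n).m
  let e : ∀ n, 𝟙_ C ⟶ X n := fun n => (S n).e
  let f : ∀ n, N.X ⟶ R.obj (X n) := fun n => (S n).f
  have he : ∀ n, e (n+1) = e n ≫ j n := fun n => rfl
  have hf : ∀ n, f (n+1) = f n ≫ R.map (j n) := fun n => rfl
  have hcompat : ∀ n, mm n ≫ j (n+1) = (j n ⊗ₘ j n) ≫ mm (n+1) := fun n => (hgood (S n)).compat
  have hassoc : ∀ n, (mm n ⊗ₘ j n) ≫ mm (n+1) = (α_ _ _ _).hom ≫ (j n ⊗ₘ mm n) ≫ mm (n+1) :=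
    fun n => (hgood (S n)).assoc
  have hone : ∀ n, (e (n+1) ⊗ₘ 𝟙 (X (n+1))) ≫ mm (n+1) = (λ_ _).hom ≫ j (n+1) :=
    fun n => (hgood (S n)).one_mul
  have hone' : ∀ n, (𝟙 (X (n+1)) ⊗ₘ e (n+1)) ≫ mm (n+1) = (ρ_ _).hom ≫ j (n+1) :=
    fun n => (hgood (S n)).mul_one
  have hfmul : ∀ n, MonObj.mul ≫ f n ≫ R.map (j n ≫ j (n+1)) =
      (f n ⊗ₘ f n) ≫ μ R _ _ ≫ R.map (mm n ≫ j (n+1)) := fun n => (hgood (S n)).fmul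
  have hfone : ∀ n, MonObj.one ≫ f n ≫ R.map (j n ≫ j (n+1)) =
      ε R ≫ R.map (e n ≫ j n ≫ j (n+1)) := fun n => (hgood (S n)).fone
  -- the universal property of the stages
  have hex : ∀ (M : Mon C) (g : N.X ⟶ R.obj M.X),
      MonObj.one ≫ g = ε R ≫ R.map MonObj.one →
      MonObj.mul ≫ g = (g ⊗ₘ g) ≫ μ R _ _ ≫ R.map MonObj.mul →
      ∃ p : ∀ n, X n ⟶ M.X, ∀ n, SHom (S n) M g (p n) (p (n+1)) := by
    intro M g g1 g2
    have step : ∀ n (p : X n ⟶ M.X) (q : X (n+1) ⟶ M.X), SHom (S n) M g p q →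
        ∃ r : X (n+2) ⟶ M.X, SHom (S (n+1)) M g q r := by
      intro n p q h
      obtain ⟨r, hr, hr'⟩ := hdesc (S n) _ _ _ (h.good g1 g2)
      refine ⟨r, ⟨hr, hr', ?_, ?_⟩⟩
      · change (e n ≫ j n) ≫ q = _
        rw [Category.assoc, show j n ≫ q = p from h.hj]
        exact h.he
      · change (f n ≫ R.map (j n)) ≫ R.map q = _
        rw [Category.assoc, ← R.map_comp, show j n ≫ q = p from h.hj]
        exact h.hf
    choose r hr using step
    obtain ⟨p₀, q₀, h₀⟩ := hs₀ M g
    let T : ∀ n, {t : (X n ⟶ M.X) × (X (n+1) ⟶ M.X) // SHom (S n) M g t.1 t.2} := fun n =>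
      Nat.rec ⟨(p₀, q₀), h₀⟩ (fun n t => ⟨(t.1.2, r n _ _ t.2), hr n _ _ t.2⟩) n
    exact ⟨fun n => (T n).1.1, fun n => (T n).2⟩
  have huniq : ∀ (M : Mon C) (g : N.X ⟶ R.obj M.X) (p p' : ∀ n, X n ⟶ M.X),
      (∀ n, SHom (S n) M g (p n) (p (n+1))) → (∀ n, SHom (S n) M g (p' n) (p' (n+1))) →
      ∀ n, p n = p' n := by
    intro M g p p' h h' n
    have : p n = p' n ∧ p (n+1) = p' (n+1) := by
      induction n with
      | zero => exact hs₀' M g _ _ _ _ (h 0) (h' 0)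
      | succ n ih =>
        refine ⟨ih.2, hext (S n) _ _ _ ((h (n+1)).hj.trans ?_) ((h (n+1)).hm.trans ?_)⟩
        · exact ih.2.trans (h' (n+1)).hj.symm
        · rw [ih.2]
          exact (h' (n+1)).hm.symm
    exact this.1
  -- the colimit
  obtain ⟨A, i, hA⟩ := exists_isSeq X j
  have hA2 := hA.tensor h₁ h₂ hA
  obtain ⟨_, heA, hmA⟩ := exists_monObj h₁ h₂ hA mm e he hcompat hassoc hone hone'
  have hfA : ∀ n, f n ≫ R.map (i n) = f 0 ≫ R.map (i 0) := by
    intro n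
    induction n with
    | zero => rfl
    | succ n ih => rw [hf, Category.assoc, ← R.map_comp, hA.w, ih]
  let MA : Mon C := ⟨A⟩
  let u : N.X ⟶ R.obj A := f 0 ≫ R.map (i 0)
  have hii : i 0 = j 0 ≫ j 1 ≫ i 2 := by rw [hA.w, hA.w]
  have hi1 : i 1 = j 1 ≫ i 2 := by rw [hA.w]
  have hu1 : MonObj.one ≫ u = ε R ≫ R.map (MonObj.one : 𝟙_ C ⟶ A) := by
    rw [← heA 0]
    have := congrArg (fun v => v ≫ R.map (i 2)) (hfone 0)
    simp only [Category.assoc, ← R.map_comp] at this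
    simp only [u, hii]
    exact this
  have hu2 : MonObj.mul ≫ u = (u ⊗ₘ u) ≫ μ R _ _ ≫ R.map (MonObj.mul : A ⊗ A ⟶ A) := by
    have := congrArg (fun v => v ≫ R.map (i 2)) (hfmul 0)
    simp only [Category.assoc, ← R.map_comp] at this
    simp only [u]
    rw [← MonoidalCategory.tensorHom_comp_tensorHom_assoc, μ_natural_assoc, ← R.map_comp, hmA, hii,
      hi1]
    exact this
  let U : N ⟶ (R.mapMon : Mon C ⥤ Mon B).obj MA :=
    { hom := u
      isMonHom_hom := ⟨hu1, hu2⟩ }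
  have hI : ∀ Y : StructuredArrow N (R.mapMon : Mon C ⥤ Mon B),
      ∃ h : MA ⟶ Y.right, U ≫ R.mapMon.map h = Y.hom ∧
        ∀ h' : MA ⟶ Y.right, U ≫ R.mapMon.map h' = Y.hom → h' = h := by
    intro Y
    let M : Mon C := Y.right
    let g : N.X ⟶ R.obj M.X := Y.hom.hom
    obtain ⟨p, hp⟩ := hex M g (IsMonHom.one_hom Y.hom.hom)
      ((IsMonHom.mul_hom Y.hom.hom).trans rfl)
    obtain ⟨r, hr⟩ := hA.desc M.X p (fun n => (hp n).hj)
    have r1 : MonObj.one ≫ r = MonObj.one := by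
      rw [← heA 0, Category.assoc, hr]
      exact (hp 0).he
    have r2 : MonObj.mul ≫ r = (r ⊗ₘ r) ≫ MonObj.mul := by
      apply hA2.ext
      intro n
      rw [← Category.assoc, hmA, Category.assoc, hr,
        MonoidalCategory.tensorHom_comp_tensorHom_assoc, hr]
      exact (hp n).hm
    refine ⟨{ hom := r, isMonHom_hom := ⟨r1, r2⟩ }, ?_, ?_⟩
    · ext
      change (f 0 ≫ R.map (i 0)) ≫ R.map r = g
      rw [Category.assoc, ← R.map_comp, hr]
      exact (hp 0).hf
    · intro h' hh'
      ext
      change h'.hom = r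
      apply hA.ext
      intro n
      rw [hr]
      refine huniq M g (fun n => i n ≫ h'.hom) p (fun n => ?_) hp n
      have hg : (f 0 ≫ R.map (i 0)) ≫ R.map h'.hom = g := congrArg Mon.Hom.hom hh'
      refine ⟨?_, ?_, ?_, ?_⟩
      · change j n ≫ i (n+1) ≫ h'.hom = _
        rw [← Category.assoc, hA.w]
      · change mm n ≫ i (n+1) ≫ h'.hom = _
        rw [← Category.assoc, ← hmA, Category.assoc,
          ← MonoidalCategory.tensorHom_comp_tensorHom_assoc]
        exact congrArg (fun v => (i n ⊗ₘ i n) ≫ v) (IsMonHom.mul_hom h'.hom)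
      · change e n ≫ i n ≫ h'.hom = _
        rw [← Category.assoc, heA]
        exact IsMonHom.one_hom h'.hom
      · change f n ≫ R.map (i n ≫ h'.hom) = _
        rw [R.map_comp, ← Category.assoc, hfA, hg]
  choose h hh hh' using hI
  exact (IsInitial.ofUniqueHom (X := StructuredArrow.mk U)
    (fun Y => StructuredArrow.homMk (h Y) (hh Y))
    (fun Y k => StructuredArrow.ext _ _ (hh' Y _ (StructuredArrow.w k)))).hasInitial

end Stage
end Aux

/-- Let `C` be a complete and cocomplete monoidal category in which tensoring on
either side preserves filtered colimits, let `B` be a monoidal category and let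
`L ⊣ R` be an adjunction with `R : C ⥤ B` lax monoidal.  Then the induced functor
`Mon_ C ⥤ Mon_ B` (sending a monoid `A` to `R A` with the monoid structure coming
from the lax monoidal structure of `R`) has a left adjoint. -/
theorem stmt7 {B : Type u₁} {C : Type u₂} [Category.{v₁} B] [Category.{v₂} C]
    [MonoidalCategory B] [MonoidalCategory C]
    [HasLimits C] [HasColimits C]
    (h₁ : ∀ X : C, PreservesFilteredColimits (tensorLeft X))
    (h₂ : ∀ X : C, PreservesFilteredColimits (tensorRight X))
    (L : B ⥤ C) (R : C ⥤ B) [R.LaxMonoidal] (adj : L ⊣ R) :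
    (R.mapMon : Mon C ⥤ Mon B).IsRightAdjoint := by
  have := fun N => Aux.main h₁ h₂ adj N
  exact isRightAdjointOfStructuredArrowInitials _
end

section
/- Let C be a small additive category. A functor F : C^op → Ab is additive if and only if it is a colimit of representables: that is, if and only if there exist a small category J, a functor u : J → C, and an isomorphism in Func(C^op, Ab) between F and the colimit of the composite diagram J → C → Func(C^op, Ab) obtained by postcomposing u with the preadditive Yoneda embedding r. -/
open CategoryTheory CategoryTheory.Limits

universe u

section aux
open Opposite

variable {C : Type u} [SmallCategory C] [Preadditive C]

theorem aux_colim {J : Type u} [SmallCategory J] (d : J ⥤ C) :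
    (colimit (d ⋙ preadditiveYoneda.{u})).Additive where
  map_add := by
    intro X Y f g
    have hc := isColimitOfPreserves ((evaluation Cᵒᵖ AddCommGrpCat.{u}).obj X)
      (colimit.isColimit (d ⋙ preadditiveYoneda.{u}))
    apply hc.hom_ext
    intro j
    have h : ∀ k : X ⟶ Y, (colimit.ι (d ⋙ preadditiveYoneda.{u}) j).app X ≫
        (colimit (d ⋙ preadditiveYoneda.{u})).map k =
        (preadditiveYoneda.obj (d.obj j)).map k ≫
          (colimit.ι (d ⋙ preadditiveYoneda.{u}) j).app Y :=
      fun k => ((colimit.ι (d ⋙ preadditiveYoneda.{u}) j).naturality k).symm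
    change (colimit.ι (d ⋙ preadditiveYoneda.{u}) j).app X ≫ _ =
      (colimit.ι (d ⋙ preadditiveYoneda.{u}) j).app X ≫ _
    rw [Preadditive.comp_add, h, h, h, Functor.map_add, Preadditive.add_comp]

/-- Category of elements: objects. -/
structure El (F : Cᵒᵖ ⥤ AddCommGrpCat.{u}) : Type u where
  pt : C
  el : F.obj (op pt)

instance (F : Cᵒᵖ ⥤ AddCommGrpCat.{u}) : SmallCategory (El F) where
  Hom a b := {f : a.pt ⟶ b.pt // F.map f.op b.el = a.el}
  id a := ⟨𝟙 _, by simp⟩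
  comp f g := ⟨f.1 ≫ g.1, by simp [f.2, g.2]⟩

/-- Projection. -/
def El.proj (F : Cᵒᵖ ⥤ AddCommGrpCat.{u}) : El F ⥤ C where
  obj a := a.pt
  map f := f.1

theorem El.ev_comp (F : Cᵒᵖ ⥤ AddCommGrpCat.{u}) {U V X : C} (f : V ⟶ U) (g : U ⟶ X)
    (x : F.obj (op X)) : F.map (f ≫ g).op x = F.map f.op (F.map g.op x) := by
  simp

theorem El.ev_add (F : Cᵒᵖ ⥤ AddCommGrpCat.{u}) [F.Additive] {U X : C} (f g : U ⟶ X)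
    (x : F.obj (op X)) : F.map (f + g).op x = F.map f.op x + F.map g.op x := by
  rw [op_add, Functor.map_add]
  rfl

/-- Yoneda map. -/
def El.leg (F : Cᵒᵖ ⥤ AddCommGrpCat.{u}) [F.Additive] (a : El F) :
    preadditiveYoneda.obj a.pt ⟶ F where
  app U := AddCommGrpCat.ofHom (AddMonoidHom.mk' (fun g : U.unop ⟶ a.pt => F.map g.op a.el)
    (fun x y => El.ev_add F x y a.el))
  naturality U V f := by
    ext g
    exact El.ev_comp F f.unop (show U.unop ⟶ a.pt from g) a.el

/-- Cocone. -/
def El.cocone (F : Cᵒᵖ ⥤ AddCommGrpCat.{u}) [F.Additive] :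
    Cocone (El.proj F ⋙ preadditiveYoneda.{u}) where
  pt := F
  ι :=
    { app := fun a => El.leg F a
      naturality := by
        intro a b f
        ext U g
        exact (El.ev_comp F (show U.unop ⟶ a.pt from g) f.1 b.el).trans
          (congrArg (fun t => F.map (show U.unop ⟶ a.pt from g).op t) f.2) }

section
variable {F : Cᵒᵖ ⥤ AddCommGrpCat.{u}} (s : Cocone (El.proj F ⋙ preadditiveYoneda.{u}))

/-- Value of a leg. -/
def El.val (a : El F) {U : C} (g : U ⟶ a.pt) : s.pt.obj (op U) :=
  (s.ι.app a).app (op U) g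

theorem El.val_add (a : El F) {U : C} (g h : U ⟶ a.pt) :
    El.val s a (g + h) = El.val s a g + El.val s a h :=
  ((s.ι.app a).app (op U)).hom.map_add g h

theorem El.val_comp (a b : El F) (f : a ⟶ b) {U : C} (g : U ⟶ a.pt) :
    El.val s b (g ≫ f.1) = El.val s a g :=
  congrArg (fun t : preadditiveYoneda.obj a.pt ⟶ s.pt => t.app (op U) g) (s.w f)

theorem El.val_nat (a : El F) {U V : C} (f : V ⟶ U) (g : U ⟶ a.pt) :
    El.val s a (f ≫ g) = s.pt.map f.op (El.val s a g) :=
  congrArg (fun t : (preadditiveYoneda.obj a.pt).obj (op U) ⟶ s.pt.obj (op V) => t g)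
    ((s.ι.app a).naturality f.op)

theorem El.val_el {U : C} (a : El F) (g : U ⟶ a.pt) (x : F.obj (op U))
    (h : F.map g.op a.el = x) : El.val s ⟨U, x⟩ (𝟙 U) = El.val s a g := by
  have := El.val_comp s ⟨U, x⟩ a ⟨g, h⟩ (𝟙 U)
  rw [← this]; simp

theorem El.desc_add [HasFiniteCoproducts C] [F.Additive] {U : C} (x y : F.obj (op U)) :
    El.val s ⟨U, x + y⟩ (𝟙 U) = El.val s ⟨U, x⟩ (𝟙 U) + El.val s ⟨U, y⟩ (𝟙 U) := by
  have : HasBinaryBiproducts C := HasBinaryBiproducts.of_hasBinaryCoproducts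
  let z : F.obj (op (U ⊞ U)) :=
    F.map (biprod.fst : U ⊞ U ⟶ U).op x + F.map (biprod.snd : U ⊞ U ⟶ U).op y
  have key : ∀ k : U ⟶ U ⊞ U, F.map k.op z =
      F.map (k ≫ biprod.fst).op x + F.map (k ≫ biprod.snd).op y := by
    intro k
    simp [z]
  have h1 : F.map (biprod.inl : U ⟶ U ⊞ U).op z = x := by
    rw [key]; simp
  have h2 : F.map (biprod.inr : U ⟶ U ⊞ U).op z = y := by
    rw [key]; simp
  have h3 : F.map (biprod.inl + biprod.inr : U ⟶ U ⊞ U).op z = x + y := by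
    rw [op_add, Functor.map_add]
    change F.map (biprod.inl : U ⟶ U ⊞ U).op z + F.map (biprod.inr : U ⟶ U ⊞ U).op z = _
    rw [h1, h2]
  rw [El.val_el s ⟨_, z⟩ _ _ h1, El.val_el s ⟨_, z⟩ _ _ h2, El.val_el s ⟨_, z⟩ _ _ h3,
    El.val_add]

/-- Descent. -/
def El.desc [HasFiniteCoproducts C] [F.Additive] : F ⟶ s.pt where
  app U := AddCommGrpCat.ofHom (AddMonoidHom.mk'
    (fun x : F.obj U => El.val s ⟨U.unop, x⟩ (𝟙 U.unop)) (fun x y => El.desc_add s x y))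
  naturality U V f := by
    ext x
    change El.val s ⟨V.unop, F.map f x⟩ (𝟙 V.unop) =
      s.pt.map f.unop.op (El.val s ⟨U.unop, x⟩ (𝟙 U.unop))
    rw [← El.val_nat, Category.comp_id]
    exact El.val_el s ⟨U.unop, x⟩ f.unop _ rfl

end

/-- Universality. -/
def El.isColimit (F : Cᵒᵖ ⥤ AddCommGrpCat.{u}) [HasFiniteCoproducts C] [F.Additive] :
    IsColimit (El.cocone F) where
  desc s := El.desc s
  fac s a := by
    ext U g
    exact El.val_el s a (show U.unop ⟶ a.pt from g) _ rfl
  uniq s m hm := by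
    ext U x
    have h := congrArg (fun t : preadditiveYoneda.obj U.unop ⟶ s.pt => t.app U (𝟙 U.unop))
      (hm ⟨U.unop, x⟩)
    change m.app U (F.map (𝟙 U.unop).op x) = _ at h
    rw [op_id, F.map_id] at h
    exact h

end aux

/-- For a small additive category `C`, a functor `F : Cᵒᵖ ⥤ Ab` is additive if and
only if it is (isomorphic to) a colimit of representables, i.e. a colimit of a
diagram obtained by postcomposing some functor `J ⥤ C` with the preadditive Yoneda
embedding. -/
theorem stmt10 {C : Type u} [SmallCategory C] [Preadditive C] [HasFiniteCoproducts C]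
    (F : Cᵒᵖ ⥤ AddCommGrpCat.{u}) :
    F.Additive ↔ ∃ (J : Cat.{u, u}) (d : J ⥤ C),
      Nonempty (F ≅ colimit (d ⋙ preadditiveYoneda)) := by
  constructor
  · intro hF
    exact ⟨Cat.of (El F), El.proj F,
      ⟨(El.isColimit F).coconePointUniqueUpToIso (colimit.isColimit _)⟩⟩
  · rintro ⟨J, d, ⟨e⟩⟩
    have := aux_colim d
    exact Functor.additive_of_iso e.symm
end

section
/- Let C be a small additive category. The inclusion functor i : Func_ad(C^op, Ab) → Func(C^op, Ab) of the full subcategory of additive functors admits a left adjoint Ad (the 'additivization'), and the composite Ad ∘ i is naturally isomorphic to the identity functor of Func_ad(C^op, Ab); that is, the additive functors form a reflective full subcategory of Func(C^op, Ab). -/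
open CategoryTheory CategoryTheory.Limits

universe u

namespace Addn

variable {C : Type u} [SmallCategory C] [Preadditive C] (F : Cᵒᵖ ⥤ AddCommGrpCat.{u})

/-- The subgroup of cross-effects. -/
def N (X : Cᵒᵖ) : AddSubgroup (F.obj X) :=
  AddSubgroup.closure {z | ∃ (Y : Cᵒᵖ) (f g : Y ⟶ X) (y : F.obj Y),
    z = F.map (f + g) y - F.map f y - F.map g y}

lemma N_le {X Y : Cᵒᵖ} (h : X ⟶ Y) : N F X ≤ (N F Y).comap (F.map h).hom := by
  refine (AddSubgroup.closure_le _).2 ?_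
  rintro _ ⟨Z, f, g, y, rfl⟩
  refine AddSubgroup.subset_closure ⟨Z, f ≫ h, g ≫ h, y, ?_⟩
  change F.map h (F.map (f + g) y - F.map f y - F.map g y) = _
  rw [← Preadditive.add_comp, map_sub, map_sub]
  simp only [F.map_comp, ConcreteCategory.comp_apply]

/-- The additivization. -/
def Q : Cᵒᵖ ⥤ AddCommGrpCat.{u} where
  obj X := AddCommGrpCat.of (F.obj X ⧸ N F X)
  map {X Y} h := AddCommGrpCat.ofHom (QuotientAddGroup.map _ _ (F.map h).hom (N_le F h))
  map_id X := by
    ext x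
    simp
  map_comp f g := by
    ext x
    simp

/-- The projection. -/
def p : F ⟶ Q F where
  app X := AddCommGrpCat.ofHom (QuotientAddGroup.mk' (N F X))
  naturality X Y f := by
    ext x
    rfl

lemma Q_additive : (Q F).Additive where
  map_add {X Y f g} := by
    ext x
    obtain ⟨x, rfl⟩ := QuotientAddGroup.mk_surjective x
    change (QuotientAddGroup.mk (F.map (f + g) x) : F.obj Y ⧸ N F Y) =
      QuotientAddGroup.mk (F.map f x) + QuotientAddGroup.mk (F.map g x)
    rw [← QuotientAddGroup.mk_add, eq_comm, QuotientAddGroup.eq]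
    refine AddSubgroup.subset_closure ⟨X, f, g, x, ?_⟩
    abel

variable {F} in
lemma N_le_ker {G : Cᵒᵖ ⥤ AddCommGrpCat.{u}} (hG : G.Additive) (a : F ⟶ G) (X : Cᵒᵖ) :
    N F X ≤ (a.app X).hom.ker := by
  refine (AddSubgroup.closure_le _).2 ?_
  rintro _ ⟨Z, f, g, y, rfl⟩
  have h (k : Z ⟶ X) : (a.app X) (F.map k y) = G.map k (a.app Z y) :=
    NatTrans.naturality_apply a k y
  change (a.app X) _ = 0
  rw [map_sub, map_sub, h, h, h, hG.map_add]
  simp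

variable {F} in
/-- The universal property. -/
def desc {G : Cᵒᵖ ⥤ AddCommGrpCat.{u}} (hG : G.Additive) (a : F ⟶ G) : Q F ⟶ G where
  app X := AddCommGrpCat.ofHom (QuotientAddGroup.lift (N F X) (a.app X).hom (N_le_ker hG a X))
  naturality X Y f := by
    ext x
    obtain ⟨x, rfl⟩ := QuotientAddGroup.mk_surjective x
    exact NatTrans.naturality_apply a f x

variable {F} in
lemma p_desc {G : Cᵒᵖ ⥤ AddCommGrpCat.{u}} (hG : G.Additive) (a : F ⟶ G) :
    p F ≫ desc hG a = a := by
  ext X x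
  rfl

variable {F} in
lemma p_ext {G : Cᵒᵖ ⥤ AddCommGrpCat.{u}} (a b : Q F ⟶ G) (h : p F ≫ a = p F ≫ b) : a = b := by
  ext X x
  obtain ⟨x, rfl⟩ := QuotientAddGroup.mk_surjective x
  exact congr($(congr_app h X) x)

/-- Hom equivalence. -/
def equiv (G : ObjectProperty.FullSubcategory (fun F : Cᵒᵖ ⥤ AddCommGrpCat.{u} => F.Additive)) :
    ((⟨Q F, Q_additive F⟩ : ObjectProperty.FullSubcategory
      (fun F : Cᵒᵖ ⥤ AddCommGrpCat.{u} => F.Additive)) ⟶ G) ≃ (F ⟶ G.obj) where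
  toFun a := p F ≫ a.hom
  invFun a := ObjectProperty.homMk (desc G.property a)
  left_inv a := by
    ext1
    exact p_ext _ _ (p_desc G.property _)
  right_inv a := p_desc G.property _

end Addn

/-- For a small additive category `C`, the inclusion of the full subcategory of
additive functors `Cᵒᵖ ⥤ Ab` into all functors admits a left adjoint `Ad`
('additivization'), and `Ad ∘ i` is naturally isomorphic to the identity; i.e. the
additive functors form a reflective full subcategory. -/
theorem stmt11 {C : Type u} [SmallCategory C] [Preadditive C] [HasFiniteCoproducts C] :
    ∃ Ad : (Cᵒᵖ ⥤ AddCommGrpCat.{u}) ⥤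
        ObjectProperty.FullSubcategory (fun F : Cᵒᵖ ⥤ AddCommGrpCat.{u} => F.Additive),
      Nonempty (Ad ⊣ ObjectProperty.ι (fun F : Cᵒᵖ ⥤ AddCommGrpCat.{u} =>
        F.Additive)) ∧
      Nonempty ((ObjectProperty.ι (fun F : Cᵒᵖ ⥤ AddCommGrpCat.{u} =>
        F.Additive) ⋙ Ad) ≅ 𝟭 _) := by
  have adj := Adjunction.adjunctionOfEquivLeft
    (G := ObjectProperty.ι (fun F : Cᵒᵖ ⥤ AddCommGrpCat.{u} => F.Additive))
    (F_obj := fun F => ⟨Addn.Q F, Addn.Q_additive F⟩) (fun F G => Addn.equiv F G)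
    (fun F G G' g h => by simp [Addn.equiv])
  exact ⟨_, ⟨adj⟩, ⟨asIso adj.counit⟩⟩
end

section
/- Let C be a small additive category, let A be a cocomplete additive category, and let γ : C → A be an additive functor. Define Sing : A → Func_ad(C^op, Ab) by letting Sing(a) be the additive functor c ↦ A(γ(c), a) (hom abelian groups in A). Then Sing admits a left adjoint Real : Func_ad(C^op, Ab) → A, and there are isomorphisms Real(rX) ≅ γ(X), natural in X ∈ C (i.e., Real ∘ r ≅ γ as functors C → A). -/
open CategoryTheory CategoryTheory.Limits

universe w u

variable {C : Type u} [SmallCategory C] [Preadditive C] [HasFiniteCoproducts C]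
variable {A : Type w} [Category.{u} A] [Preadditive A] [HasColimits A]

/-- The preadditive Yoneda embedding, viewed as landing in the full subcategory of
additive functors `Cᵒᵖ ⥤ Ab`. -/
def rAd : C ⥤ ObjectProperty.FullSubcategory (fun F : Cᵒᵖ ⥤ AddCommGrpCat.{u} => F.Additive) :=
  ObjectProperty.lift _ preadditiveYoneda (fun _ => inferInstance)

/-- The functor `Sing : A ⥤ Func_ad(Cᵒᵖ, Ab)` associated to an additive functor
`γ : C ⥤ A`, sending `a` to the additive functor `c ↦ A(γ c, a)`. -/
def Sing (γ : C ⥤ A) [γ.Additive] :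
    A ⥤ ObjectProperty.FullSubcategory (fun F : Cᵒᵖ ⥤ AddCommGrpCat.{u} => F.Additive) :=
  ObjectProperty.lift _
    (preadditiveYoneda ⋙ (Functor.whiskeringLeft Cᵒᵖ Aᵒᵖ AddCommGrpCat.{u}).obj γ.op)
    (fun a => by
      dsimp
      exact inferInstanceAs ((γ.op ⋙ preadditiveYoneda.obj a).Additive))

/-- The underlying presheaf of sets of an additive functor. -/
abbrev undAd (C : Type u) [SmallCategory C] [Preadditive C] :
    ObjectProperty.FullSubcategory (fun F : Cᵒᵖ ⥤ AddCommGrpCat.{u} => F.Additive) ⥤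
      (Cᵒᵖ ⥤ Type u) :=
  ObjectProperty.ι _ ⋙ (Functor.whiskeringRight Cᵒᵖ AddCommGrpCat.{u} (Type u)).obj
    (forget AddCommGrpCat.{u})

theorem undAd_additive (F G : Cᵒᵖ ⥤ AddCommGrpCat.{u}) [F.Additive] [G.Additive]
    (t : F ⋙ forget AddCommGrpCat.{u} ⟶ G ⋙ forget AddCommGrpCat.{u}) (X : Cᵒᵖ)
    (a b : F.obj X) :
    (show G.obj X from t.app X (show F.obj X from a + b)) =
      (show G.obj X from t.app X a) + (show G.obj X from t.app X b) := by
  haveI : HasBinaryBiproducts C := HasBinaryBiproducts.of_hasBinaryCoproducts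
  have nat : ∀ {Y Z : Cᵒᵖ} (f : Y ⟶ Z) (y : F.obj Y),
      (show G.obj Z from t.app Z (F.map f y)) = G.map f (show G.obj Y from t.app Y y) :=
    fun f y => t.naturality_apply f y
  let B : C := X.unop ⊞ X.unop
  let l : Opposite.op B ⟶ X := (biprod.inl : X.unop ⟶ B).op
  let r : Opposite.op B ⟶ X := (biprod.inr : X.unop ⟶ B).op
  let p : X ⟶ Opposite.op B := (biprod.fst : B ⟶ X.unop).op
  let q : X ⟶ Opposite.op B := (biprod.snd : B ⟶ X.unop).op
  have pl : p ≫ l = 𝟙 X := by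
    apply Quiver.Hom.unop_inj; simp [p, l, B]
  have pr : p ≫ r = 0 := by
    apply Quiver.Hom.unop_inj; simp [p, r, B]
  have ql : q ≫ l = 0 := by
    apply Quiver.Hom.unop_inj; simp [q, l, B]
  have qr : q ≫ r = 𝟙 X := by
    apply Quiver.Hom.unop_inj; simp [q, r, B]
  let y : F.obj (Opposite.op B) := F.map p a + F.map q b
  have hl : F.map l y = a := by
    simp only [y, map_add]
    rw [← ConcreteCategory.comp_apply, ← ConcreteCategory.comp_apply, ← F.map_comp,
      ← F.map_comp, pl, ql]
    simp
  have hr : F.map r y = b := by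
    simp only [y, map_add]
    rw [← ConcreteCategory.comp_apply, ← ConcreteCategory.comp_apply, ← F.map_comp,
      ← F.map_comp, pr, qr]
    simp
  have hs : F.map (l + r) y = a + b := by
    rw [F.map_add, AddCommGrpCat.hom_add_apply, hl, hr]
  have h1 := nat (l + r) y
  rw [G.map_add, AddCommGrpCat.hom_add_apply, ← nat l y, ← nat r y, hs, hl, hr] at h1
  exact h1

theorem undAd_full : (undAd C).Full where
  map_surjective {F G} t := by
    haveI := F.property
    haveI := G.property
    refine ⟨ObjectProperty.homMk
      { app := fun X => AddCommGrpCat.ofHom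
          (AddMonoidHom.mk' (fun a : F.obj.obj X => (show G.obj.obj X from t.app X a))
            (undAd_additive F.obj G.obj t X))
        naturality := fun X Y f => by
          ext a
          exact t.naturality_apply f a }, ?_⟩
    rfl

theorem undAd_faithful : (undAd C).Faithful := inferInstance

/-- `yoneda` and `uliftYoneda` agree up to isomorphism. -/
def yonedaIsoAd (D : Type w) [Category.{u} D] :
    (yoneda : D ⥤ Dᵒᵖ ⥤ Type u) ≅ uliftYoneda.{u} :=
  NatIso.ofComponents (fun X => NatIso.ofComponents
    (fun Y => Equiv.toIso Equiv.ulift.symm) (fun f => rfl)) (fun f => rfl)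

/-- Let `C` be a small additive category, `A` a cocomplete additive category and
`γ : C ⥤ A` an additive functor.  Then the functor `Sing : A ⥤ Func_ad(Cᵒᵖ, Ab)`,
`a ↦ (c ↦ A(γ c, a))`, admits a left adjoint `Real`, and `Real ∘ r ≅ γ` where `r`
is the preadditive Yoneda embedding. -/
theorem stmt12 (γ : C ⥤ A) [γ.Additive] :
    ∃ Real : ObjectProperty.FullSubcategory (fun F : Cᵒᵖ ⥤ AddCommGrpCat.{u} => F.Additive) ⥤ A,
      Nonempty (Real ⊣ Sing γ) ∧ Nonempty ((rAd (C := C) ⋙ Real) ≅ γ) := by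
  haveI := undAd_full (C := C)
  let L : (Cᵒᵖ ⥤ Type u) ⥤ A := (uliftYoneda.{u} : C ⥤ Cᵒᵖ ⥤ Type u).leftKanExtension γ
  let adj : L ⊣ Presheaf.restrictedULiftYoneda.{u} γ :=
    Presheaf.uliftYonedaAdjunction.{u} L
      ((uliftYoneda.{u} : C ⥤ Cᵒᵖ ⥤ Type u).leftKanExtensionUnit γ)
  let e1 : rAd ⋙ undAd C ≅ uliftYoneda.{u} :=
    (show rAd ⋙ undAd C ≅ yoneda from
      eqToIso (whiskering_preadditiveYoneda (C := C))) ≪≫ yonedaIsoAd C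
  let e2 : Sing γ ⋙ undAd C ≅ Presheaf.restrictedULiftYoneda.{u} γ :=
    Functor.isoWhiskerRight
      ((show preadditiveYoneda ⋙ (Functor.whiskeringRight Aᵒᵖ AddCommGrpCat.{u} (Type u)).obj
        (forget AddCommGrpCat.{u}) ≅ yoneda from
          eqToIso (whiskering_preadditiveYoneda (C := A))) ≪≫ yonedaIsoAd A)
      ((Functor.whiskeringLeft _ _ _).obj γ.op)
  refine ⟨undAd C ⋙ L, ⟨?_⟩, ⟨?_⟩⟩
  · exact adj.restrictFullyFaithful (Functor.FullyFaithful.ofFullyFaithful (undAd C))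
      (Functor.FullyFaithful.id A) (Functor.rightUnitor _).symm
      (Functor.leftUnitor _ ≪≫ e2.symm)
  · exact (Functor.associator _ _ _).symm ≪≫ Functor.isoWhiskerRight e1 L ≪≫
      Presheaf.isExtensionAlongULiftYoneda.{u} γ
end

section
/- Let ssSet denote the category of bisimplicial sets, i.e. functors (Δ × Δ)^op → Set. For k, n ≥ 0 let b_{k,n} denote the corner map (∂Δ[k] ⊠ Δ[n]) ∪_{(∂Δ[k] ⊠ ∂Δ[n])} (Δ[k] ⊠ ∂Δ[n]) → Δ[k] ⊠ Δ[n], the pushout-product of the boundary inclusions ∂Δ[k] → Δ[k] and ∂Δ[n] → Δ[n] under the external product. Then every monomorphism of bisimplicial sets can be obtained from the maps b_{k,n} by iterated cobase change (pushout) and transfinite composition; in particular, the class of monomorphisms of bisimplicial sets is the smallest class of morphisms that contains all the maps b_{k,n} and is closed under pushouts along arbitrary maps and under transfinite composition. -/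
open CategoryTheory CategoryTheory.Limits Simplicial Opposite

universe u

/-- The category of bisimplicial sets: functors `(Δ × Δ)ᵒᵖ ⥤ Type u`. -/
abbrev BiSSet := (SimplexCategory × SimplexCategory)ᵒᵖ ⥤ Type u

namespace Stmt15

/-- The external product `K ⊠ L` of two simplicial sets: the bisimplicial set
`([m], [n]) ↦ K_m × L_n`. -/
def extProd (K L : SSet.{u}) : BiSSet.{u} where
  obj p := K.obj (op p.unop.1) × L.obj (op p.unop.2)
  map f := ↾fun s => (K.map (Quiver.Hom.op f.unop.1) s.1, L.map (Quiver.Hom.op f.unop.2) s.2)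
  map_id p := by ext s <;> simp
  map_comp f g := by ext s <;> simp

/-- The external product of two morphisms of simplicial sets. -/
def extProdMap {K K' L L' : SSet.{u}} (f : K ⟶ K') (g : L ⟶ L') :
    extProd K L ⟶ extProd K' L' where
  app p := ↾fun s => (f.app (op p.unop.1) s.1, g.app (op p.unop.2) s.2)
  naturality p q φ := by
    refine ConcreteCategory.hom_ext _ _ fun (s : K.obj (op p.unop.1) × L.obj (op p.unop.2)) => ?_
    have hf := ConcreteCategory.congr_hom (f.naturality (Quiver.Hom.op φ.unop.1)) s.1
    have hg := ConcreteCategory.congr_hom (g.naturality (Quiver.Hom.op φ.unop.2)) s.2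
    exact Prod.ext hf hg

/-- The corner map (pushout-product of the two boundary inclusions under the
external product):
`(∂Δ[k] ⊠ Δ[n]) ∪_{∂Δ[k] ⊠ ∂Δ[n]} (Δ[k] ⊠ ∂Δ[n]) ⟶ Δ[k] ⊠ Δ[n]`. -/
noncomputable def cornerMap (k n : ℕ) :
    pushout (extProdMap (𝟙 (∂Δ[k] : SSet.{u})) (SSet.boundary n).ι)
        (extProdMap (SSet.boundary k).ι (𝟙 (∂Δ[n] : SSet.{u}))) ⟶
      extProd (Δ[k] : SSet.{u}) (Δ[n] : SSet.{u}) :=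
  pushout.desc (extProdMap (SSet.boundary k).ι (𝟙 (Δ[n] : SSet.{u})))
    (extProdMap (𝟙 (Δ[k] : SSet.{u})) (SSet.boundary n).ι) rfl

variable {𝒞 : Type*} [Category 𝒞]

/-- The inclusion functor of the initial segment `Set.Iio b` into a preorder. -/
def iioIncl {β : Type*} [Preorder β] (b : β) : Set.Iio b ⥤ β :=
  Monotone.functor (f := fun x : Set.Iio b => (x : β)) (fun _ _ h => h)

/-- For a diagram `T : β ⥤ 𝒞` and `b : β`, the cocone on the restriction of `T`
to `Set.Iio b` with vertex `T.obj b`.  Asking this cocone to be a colimit for all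
limit elements `b` expresses that `T` is continuous ('smooth') at limits. -/
def iioCocone {β : Type*} [Preorder β] (T : β ⥤ 𝒞) (b : β) :
    Cocone (iioIncl b ⋙ T) where
  pt := T.obj b
  ι :=
    { app := fun x => T.map (homOfLE x.2.le)
      naturality := fun x y f => by
        dsimp [iioIncl]
        rw [← T.map_comp, Category.comp_id]
        rfl }

/-- A class `S` of morphisms of bisimplicial sets is stable under transfinite
composition if for every well-ordered type `β` with a bottom element, every
diagram `T : β ⥤ BiSSet` all of whose successor maps lie in `S` and which is
continuous at limit elements, and every colimit cocone `c` on `T`, the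
transfinite composite `T ⊥ ⟶ c.pt` lies in `S`. -/
def IsStableUnderTransfiniteComposition (S : MorphismProperty BiSSet.{u}) : Prop :=
  ∀ (β : Type u) [LinearOrder β] [OrderBot β] [SuccOrder β] [WellFoundedLT β],
    ∀ T : β ⥤ BiSSet.{u},
      (∀ b : β, ¬IsMax b → S (T.map (homOfLE (Order.le_succ b)))) →
      (∀ b : β, Order.IsSuccLimit b → Nonempty (IsColimit (iioCocone T b))) →
      ∀ c : Cocone T, IsColimit c → S (c.ι.app ⊥)

/-- Bisimplices of `Y`. -/
abbrev Cells (Y : BiSSet.{u}) : Type u := Σ kn : ℕ × ℕ, Y.obj (op (⦋kn.1⦌, ⦋kn.2⦌))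

lemma exists_order (Y : BiSSet.{u}) : ∃ (o : LinearOrder (Cells Y)),
    @WellFoundedLT (Cells Y) o.toLT ∧
    ∀ c d : Cells Y, c.1.1 + c.1.2 < d.1.1 + d.1.2 → o.lt c d := by
  classical
  let o' : LinearOrder (Cells Y) := linearOrderOfSTO WellOrderingRel
  have : WellFoundedLT (Cells Y) := ⟨(inferInstance : IsWellFounded (Cells Y) WellOrderingRel).wf⟩
  let φ : Cells Y → ℕ ×ₗ Cells Y := fun c => toLex (c.1.1 + c.1.2, c)
  have hφ : Function.Injective φ := fun c d h => by
    have := congrArg (fun z => (ofLex z).2) h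
    exact this
  refine ⟨LinearOrder.lift' φ hφ, ?_, ?_⟩
  · exact ⟨InvImage.wf φ (wellFounded_lt (α := ℕ ×ₗ Cells Y))⟩
  · intro c d h
    change φ c < φ d
    rw [Prod.Lex.lt_iff]
    exact Or.inl h

lemma exists_section {a b : SimplexCategory} (f : a ⟶ b) (hf : Function.Surjective f.toOrderHom)
    (x : Fin (a.len + 1)) :
    ∃ s : b ⟶ a, s ≫ f = 𝟙 b ∧ s.toOrderHom (f.toOrderHom x) = x := by
  classical
  let α (y : Fin (b.len + 1)) : Fin (a.len + 1) :=
    if y = f.toOrderHom x then x else (hf y).choose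
  have hα₁ (y : Fin (b.len + 1)) : f.toOrderHom (α y) = y := by
    dsimp only [α]
    split_ifs with hy
    · rw [hy]
    · exact (hf y).choose_spec
  have hα₂ : Monotone α := by
    rintro y₁ y₂ h
    by_contra! h'
    have h2 : y₂ ≤ y₁ := by simpa only [hα₁] using f.toOrderHom.monotone h'.le
    rw [le_antisymm h h2] at h'
    exact lt_irrefl _ h'
  refine ⟨SimplexCategory.Hom.mk ⟨α, hα₂⟩, ?_, ?_⟩
  · ext y : 3
    exact hα₁ y
  · simp [α]

/-- Both components surjective. -/
def BiSurj {p q : SimplexCategory × SimplexCategory} (f : p ⟶ q) : Prop :=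
  Function.Surjective f.1.toOrderHom ∧ Function.Surjective f.2.toOrderHom

lemma BiSurj.eq_id {p : SimplexCategory × SimplexCategory} {f : p ⟶ p} (h : BiSurj f) :
    f = 𝟙 p := by
  have : Epi f.1 := SimplexCategory.epi_iff_surjective.2 h.1
  have : Epi f.2 := SimplexCategory.epi_iff_surjective.2 h.2
  exact Prod.ext (SimplexCategory.eq_id_of_epi _) (SimplexCategory.eq_id_of_epi _)

lemma exists_bisection {p q : SimplexCategory × SimplexCategory} (f : p ⟶ q) (hf : BiSurj f)
    (x : Fin (p.1.len + 1)) (y : Fin (p.2.len + 1)) :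
    ∃ s : q ⟶ p, s ≫ f = 𝟙 q ∧ s.1.toOrderHom (f.1.toOrderHom x) = x ∧
      s.2.toOrderHom (f.2.toOrderHom y) = y := by
  obtain ⟨s, hs, hs'⟩ := exists_section f.1 hf.1 x
  obtain ⟨t, ht, ht'⟩ := exists_section f.2 hf.2 y
  exact ⟨(s, t), Prod.ext hs ht, hs', ht'⟩

lemma eq_of_map_eq {Y : BiSSet.{u}} (A : Subfunctor Y) {q : SimplexCategory × SimplexCategory}
    (y : Y.obj (op q)) (hy : y ∉ A.obj _)
    (hface : ∀ (p : SimplexCategory × SimplexCategory) (f : p ⟶ q), ¬ BiSurj f →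
      Y.map f.op y ∈ A.obj (op p))
    {p : SimplexCategory × SimplexCategory} (f g : p ⟶ q) (hf : BiSurj f)
    (h : Y.map f.op y = Y.map g.op y) : f = g := by
  have key : ∀ s : q ⟶ p, s ≫ f = 𝟙 q → s ≫ g = 𝟙 q := by
    intro s hs
    apply BiSurj.eq_id
    by_contra hns
    apply hy
    have h1 := hface _ _ hns
    rw [op_comp, Functor.map_comp, comp_apply, ← h, ← comp_apply, ← Functor.map_comp,
      ← op_comp, hs] at h1
    simpa using h1
  refine Prod.ext ?_ ?_
  · ext x : 3
    obtain ⟨s, hs, h1, -⟩ := exists_bisection f hf x 0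
    have h3 := SimplexCategory.congr_toOrderHom_apply (congrArg Prod.fst (key s hs))
      (f.1.toOrderHom x)
    change g.1.toOrderHom (s.1.toOrderHom (f.1.toOrderHom x)) = _ at h3
    rw [h1] at h3
    exact h3.symm
  · ext x : 3
    obtain ⟨s, hs, -, h1⟩ := exists_bisection f hf 0 x
    have h3 := SimplexCategory.congr_toOrderHom_apply (congrArg Prod.snd (key s hs))
      (f.2.toOrderHom x)
    change g.2.toOrderHom (s.2.toOrderHom (f.2.toOrderHom x)) = _ at h3
    rw [h1] at h3
    exact h3.symm

/-- the map of standard bisimplices to morphisms -/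
def homOf {k n : ℕ} {p : (SimplexCategory × SimplexCategory)ᵒᵖ}
    (s : (extProd (Δ[k] : SSet.{u}) (Δ[n] : SSet.{u})).obj p) :
    p.unop ⟶ (⦋k⦌, ⦋n⦌) := (s.1.down, s.2.down)

lemma homOf_injective {k n : ℕ} {p : (SimplexCategory × SimplexCategory)ᵒᵖ} :
    Function.Injective (homOf.{u} (k := k) (n := n) (p := p)) := by
  intro s t h
  have h1 : s.1 = t.1 := ULift.ext _ _ (congrArg Prod.fst h)
  have h2 : s.2 = t.2 := ULift.ext _ _ (congrArg Prod.snd h)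
  exact Prod.ext h1 h2

/-- the classifying map of a bisimplex -/
def yo {Y : BiSSet.{u}} {k n : ℕ} (y : Y.obj (op (⦋k⦌, ⦋n⦌))) :
    extProd (Δ[k] : SSet.{u}) (Δ[n] : SSet.{u}) ⟶ Y where
  app p := ↾fun s => Y.map (homOf s).op y
  naturality p q φ := by
    refine ConcreteCategory.hom_ext _ _ fun s => ?_
    change Y.map (φ.unop ≫ homOf s).op y = Y.map φ (Y.map (homOf s).op y)
    rw [op_comp, Functor.map_comp]
    rfl

lemma corner_sq (k n : ℕ) (p : (SimplexCategory × SimplexCategory)ᵒᵖ) :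
    IsPushout ((extProdMap (𝟙 (∂Δ[k] : SSet.{u})) (SSet.boundary n).ι).app p)
      ((extProdMap (SSet.boundary k).ι (𝟙 (∂Δ[n] : SSet.{u}))).app p)
      ((pushout.inl (extProdMap (𝟙 (∂Δ[k] : SSet.{u})) (SSet.boundary n).ι)
        (extProdMap (SSet.boundary k).ι (𝟙 (∂Δ[n] : SSet.{u})))).app p)
      ((pushout.inr (extProdMap (𝟙 (∂Δ[k] : SSet.{u})) (SSet.boundary n).ι)
        (extProdMap (SSet.boundary k).ι (𝟙 (∂Δ[n] : SSet.{u})))).app p) :=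
  (IsPushout.of_hasPushout (extProdMap (𝟙 (∂Δ[k] : SSet.{u})) (SSet.boundary n).ι)
        (extProdMap (SSet.boundary k).ι (𝟙 (∂Δ[n] : SSet.{u})))).map ((evaluation _ _).obj p)

lemma inl_corner (k n : ℕ) : pushout.inl (extProdMap (𝟙 (∂Δ[k] : SSet.{u})) (SSet.boundary n).ι)
        (extProdMap (SSet.boundary k).ι (𝟙 (∂Δ[n] : SSet.{u}))) ≫ cornerMap k n =
      extProdMap (SSet.boundary k).ι (𝟙 (Δ[n] : SSet.{u})) :=
  pushout.inl_desc _ _ _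

lemma inr_corner (k n : ℕ) : pushout.inr (extProdMap (𝟙 (∂Δ[k] : SSet.{u})) (SSet.boundary n).ι)
        (extProdMap (SSet.boundary k).ι (𝟙 (∂Δ[n] : SSet.{u}))) ≫ cornerMap k n =
      extProdMap (𝟙 (Δ[k] : SSet.{u})) (SSet.boundary n).ι :=
  pushout.inr_desc _ _ _

lemma corner_inl (k n : ℕ) (p : (SimplexCategory × SimplexCategory)ᵒᵖ)
    (x : (extProd (∂Δ[k] : SSet.{u}) (Δ[n] : SSet.{u})).obj p) :
    (cornerMap k n).app p ((pushout.inl (extProdMap (𝟙 (∂Δ[k] : SSet.{u})) (SSet.boundary n).ι)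
        (extProdMap (SSet.boundary k).ι (𝟙 (∂Δ[n] : SSet.{u})))).app p x) = (x.1.1, x.2) :=
  ConcreteCategory.congr_hom (NatTrans.congr_app (inl_corner.{u} k n) p) x

lemma corner_inr (k n : ℕ) (p : (SimplexCategory × SimplexCategory)ᵒᵖ)
    (x : (extProd (Δ[k] : SSet.{u}) (∂Δ[n] : SSet.{u})).obj p) :
    (cornerMap k n).app p ((pushout.inr (extProdMap (𝟙 (∂Δ[k] : SSet.{u})) (SSet.boundary n).ι)
        (extProdMap (SSet.boundary k).ι (𝟙 (∂Δ[n] : SSet.{u})))).app p x) = (x.1, x.2.1) :=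
  ConcreteCategory.congr_hom (NatTrans.congr_app (inr_corner.{u} k n) p) x

lemma mem_range_corner (k n : ℕ) (p : (SimplexCategory × SimplexCategory)ᵒᵖ)
    (s : (extProd (Δ[k] : SSet.{u}) (Δ[n] : SSet.{u})).obj p) :
    s ∈ Set.range ((cornerMap k n).app p) ↔ ¬ BiSurj (homOf s) := by
  constructor
  · rintro ⟨z, rfl⟩
    rcases Types.eq_or_eq_of_isPushout (corner_sq k n p) z with ⟨x, rfl⟩ | ⟨x, rfl⟩
    · intro h
      have := corner_inl k n p x
      erw [this] at h
      exact x.1.2 h.1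
    · intro h
      have := corner_inr k n p x
      erw [this] at h
      exact x.2.2 h.2
  · intro h
    by_cases h1 : Function.Surjective (homOf s).1.toOrderHom
    · have h2 : s.2 ∈ (SSet.boundary n).obj (op p.unop.2) := fun h2 => h ⟨h1, h2⟩
      exact ⟨_, corner_inr k n p (s.1, ⟨s.2, h2⟩)⟩
    · exact ⟨_, corner_inl k n p (⟨s.1, h1⟩, s.2)⟩

lemma mono_corner (k n : ℕ) : Mono (cornerMap.{u} k n) := by
  rw [NatTrans.mono_iff_mono_app]
  intro p
  have hmono : Mono ((extProdMap (SSet.boundary k).ι (𝟙 (Δ[n] : SSet.{u}))).app p) := by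
    rw [mono_iff_injective]
    rintro ⟨x1, x2⟩ ⟨y1, y2⟩ h
    have h' : ((x1.1, x2) : (Δ[k] : SSet.{u}).obj (op p.unop.1) × (Δ[n] : SSet.{u}).obj (op p.unop.2)) = (y1.1, y2) := h
    exact Prod.ext (Subtype.ext (Prod.mk.inj h').1) (Prod.mk.inj h').2
  refine Types.mono_of_isPushout_of_isPullback (corner_sq k n p)
    (r' := (extProdMap (SSet.boundary k).ι (𝟙 (Δ[n] : SSet.{u}))).app p)
    (b' := (extProdMap (𝟙 (Δ[k] : SSet.{u})) (SSet.boundary n).ι).app p) ?_ ?_ ?_ ?_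
  · rw [Types.isPullback_iff]
    refine ⟨rfl, ?_, ?_⟩
    · rintro ⟨x1, x2⟩ ⟨y1, y2⟩ ⟨h1, h2⟩
      have h1' : ((x1, x2.1) : (∂Δ[k] : SSet.{u}).obj (op p.unop.1) × (Δ[n] : SSet.{u}).obj (op p.unop.2)) = (y1, y2.1) := h1
      have h2' : ((x1.1, x2) : (Δ[k] : SSet.{u}).obj (op p.unop.1) × (∂Δ[n] : SSet.{u}).obj (op p.unop.2)) = (y1.1, y2) := h2
      exact Prod.ext (Prod.mk.inj h1').1 (Prod.mk.inj h2').2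
    · rintro ⟨x1, x2⟩ ⟨y1, y2⟩ h
      have h' : ((x1.1, x2) : (Δ[k] : SSet.{u}).obj (op p.unop.1) × (Δ[n] : SSet.{u}).obj (op p.unop.2)) = (y1, y2.1) := h
      exact ⟨(x1, y2), Prod.ext rfl (Prod.mk.inj h').2.symm, Prod.ext (Prod.mk.inj h').1 rfl⟩
  · ext x
    exact corner_inl k n p x
  · ext x
    exact corner_inr k n p x
  · rintro ⟨x1, x2⟩ ⟨y1, y2⟩ _ _ h
    have h' : ((x1, x2.1) : (Δ[k] : SSet.{u}).obj (op p.unop.1) × (Δ[n] : SSet.{u}).obj (op p.unop.2)) = (y1, y2.1) := h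
    exact Prod.ext (Prod.mk.inj h').1 (Subtype.ext (Prod.mk.inj h').2)

lemma attach {Y : BiSSet.{u}} (A B : Subfunctor Y) (hAB : A ≤ B) {k n : ℕ}
    (y : Y.obj (op (⦋k⦌, ⦋n⦌))) (hy : y ∉ A.obj _)
    (hface : ∀ (p : SimplexCategory × SimplexCategory) (f : p ⟶ (⦋k⦌, ⦋n⦌)), ¬ BiSurj f →
      Y.map f.op y ∈ A.obj (op p))
    (hB : B = A ⊔ Subfunctor.ofSection y) :
    ∃ t b, IsPushout t (cornerMap.{u} k n) (Subfunctor.homOfLe hAB) b := by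
  have hr : Subfunctor.range (cornerMap.{u} k n ≫ yo y) ≤ A := by
    rintro p _ ⟨x, rfl⟩
    exact hface _ _ ((mem_range_corner k n p _).1 ⟨x, rfl⟩)
  have hr' : Subfunctor.range (yo y) ≤ B := by
    rintro p _ ⟨x, rfl⟩
    rw [hB]
    exact Or.inr ⟨(homOf x).op, rfl⟩
  refine ⟨Subfunctor.lift _ hr, Subfunctor.lift _ hr', ⟨⟨rfl⟩, ⟨evaluationJointlyReflectsColimits _
    (fun p => ?_)⟩⟩⟩
  refine (isColimitMapCoconePushoutCoconeEquiv _ _).2 (IsPushout.isColimit ?_)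
  have hm : Mono ((Subfunctor.homOfLe hAB).app p) := by
    rw [mono_iff_injective]
    intro a b h
    have h' : a.1 = b.1 := congrArg (fun z : (B.toFunctor).obj p => z.1) h
    exact Subtype.ext h'
  have hm' : Mono ((cornerMap.{u} k n).app p) := by
    have := mono_corner.{u} k n
    infer_instance
  refine Types.isPushout_of_isPullback_of_mono' ?_ ?_ ?_
  · rw [Types.isPullback_iff]
    refine ⟨rfl, ?_, ?_⟩
    · rintro x z ⟨-, h⟩
      exact (mono_iff_injective _).1 hm' h
    · intro a s h
      have h' : a.1 = Y.map (homOf s).op y := congrArg Subtype.val h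
      have hs : ¬ BiSurj (homOf s) := by
        intro hs
        apply hy
        obtain ⟨σ, hσ, -⟩ := exists_bisection _ hs 0 0
        have h1 := A.map σ.op a.2
        rw [Set.mem_preimage, h', ← comp_apply, ← Functor.map_comp, ← op_comp, hσ] at h1
        rw [op_id, CategoryTheory.Functor.map_id] at h1
        exact h1
      obtain ⟨x, rfl⟩ := (mem_range_corner k n p s).2 hs
      exact ⟨x, Subtype.ext h'.symm, rfl⟩
  · rw [Set.eq_univ_iff_forall]
    rintro ⟨z, hz⟩
    have hz' := hz
    rw [hB] at hz'
    rcases hz' with h | ⟨f, rfl⟩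
    · exact Or.inl ⟨⟨z, h⟩, rfl⟩
    · exact Or.inr ⟨(⟨f.unop.1⟩, ⟨f.unop.2⟩), rfl⟩
  · intro s s' hs hs' h
    apply homOf_injective
    refine eq_of_map_eq A y hy hface _ _ ?_ (congrArg Subtype.val h)
    by_contra hn
    exact hs ((mem_range_corner k n p s).2 hn)

lemma face_mem {Y : BiSSet.{u}} (A : Subfunctor Y) {k n : ℕ}
    (y : Y.obj (op (⦋k⦌, ⦋n⦌)))
    (hA : ∀ k' n' (z : Y.obj (op (⦋k'⦌, ⦋n'⦌))), k' + n' < k + n → z ∈ A.obj _)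
    (p : SimplexCategory × SimplexCategory) (f : p ⟶ (⦋k⦌, ⦋n⦌)) (hf : ¬ BiSurj f) :
      Y.map f.op y ∈ A.obj (op p) := by
  by_cases h1 : Function.Surjective f.1.toOrderHom
  · have h2 : ¬ Function.Surjective f.2.toOrderHom := fun h2 => hf ⟨h1, h2⟩
    cases n with
    | zero =>
      exfalso
      apply h2
      intro z
      exact ⟨0, Subsingleton.elim (α := Fin 1) _ _⟩
    | succ n =>
      obtain ⟨i, θ, hθ⟩ := SimplexCategory.eq_comp_δ_of_not_surjective _ h2
      have : f = (show p ⟶ (⦋k⦌, ⦋n⦌) from (f.1, θ)) ≫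
          (show (⦋k⦌, ⦋n⦌) ⟶ (⦋k⦌, ⦋n+1⦌) from (𝟙 _, SimplexCategory.δ i)) :=
        Prod.ext (Category.comp_id _).symm hθ
      rw [this, op_comp, Functor.map_comp, comp_apply]
      exact A.map _ (hA _ _ _ (by omega))
  · cases k with
    | zero =>
      exfalso
      apply h1
      intro z
      exact ⟨0, Subsingleton.elim (α := Fin 1) _ _⟩
    | succ k =>
      obtain ⟨i, θ, hθ⟩ := SimplexCategory.eq_comp_δ_of_not_surjective _ h1
      have : f = (show p ⟶ (⦋k⦌, ⦋n⦌) from (θ, f.2)) ≫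
          (show (⦋k⦌, ⦋n⦌) ⟶ (⦋k+1⦌, ⦋n⦌) from (SimplexCategory.δ i, 𝟙 _)) :=
        Prod.ext hθ (Category.comp_id _).symm
      rw [this, op_comp, Functor.map_comp, comp_apply]
      exact A.map _ (hA _ _ _ (by omega))

/-- The diagram of subfunctors. -/
def subDiagram {Y : BiSSet.{u}} {β : Type u} [Preorder β] (A : β → Subfunctor Y)
    (hA : Monotone A) : β ⥤ BiSSet.{u} where
  obj b := (A b).toFunctor
  map f := Subfunctor.homOfLe (hA (leOfHom f))
  map_id _ := rfl
  map_comp _ _ := rfl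

lemma subDiagram_colimit {Y : BiSSet.{u}} {β : Type u} [LinearOrder β] (A : β → Subfunctor Y)
    (hA : Monotone A) (b : β) (hne : ∃ a, a < b) (h : ∀ p, ∀ x ∈ (A b).obj p, ∃ a < b, x ∈ (A a).obj p) :
    Nonempty (IsColimit (iioCocone (subDiagram A hA) b)) := by
  have : Nonempty (Set.Iio b) := by
    obtain ⟨a, ha⟩ := hne
    exact ⟨⟨a, ha⟩⟩
  refine ⟨evaluationJointlyReflectsColimits _ (fun p => ?_)⟩
  refine Types.FilteredColimit.isColimitOf _ _ ?_ ?_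
  · rintro ⟨x, hx⟩
    obtain ⟨a, ha, hxa⟩ := h p x hx
    exact ⟨⟨a, ha⟩, ⟨x, hxa⟩, rfl⟩
  · intro i j x z hxz
    refine ⟨max i j, homOfLE (le_max_left _ _), homOfLE (le_max_right _ _), ?_⟩
    have : x.1 = z.1 := congrArg Subtype.val hxz
    exact Subtype.ext this

lemma iso_mem {S : MorphismProperty BiSSet.{u}} (hS : IsStableUnderTransfiniteComposition S)
    {X Y : BiSSet.{u}} (f : X ⟶ Y) [IsIso f] : S f := by
  let T : PUnit.{u+1} ⥤ BiSSet.{u} := (Functor.const _).obj X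
  let c : Cocone T := ⟨Y, { app := fun _ => f }⟩
  let : SuccOrder PUnit.{u+1} := SuccOrder.ofLinearWellFoundedLT _
  refine hS PUnit.{u+1} T ?_ ?_ c ?_
  · intro b hb
    exact (hb (fun _ _ => le_of_eq (Subsingleton.elim _ _))).elim
  · intro b hb
    exact (hb.1 (fun _ _ => le_of_eq (Subsingleton.elim _ _))).elim
  · exact
      { desc := fun s => inv f ≫ s.ι.app PUnit.unit
        fac := fun s j => by simp [c]
        uniq := fun s m hm => by
          have := hm PUnit.unit
          rw [← this]
          simp [c] }

lemma mono_mem {S : MorphismProperty BiSSet.{u}} (hc : ∀ k n : ℕ, S (cornerMap k n))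
    (hS' : S.IsStableUnderCobaseChange)
    (hS : IsStableUnderTransfiniteComposition S) {X Y : BiSSet.{u}} (f : X ⟶ Y) [Mono f] : S f := by
  obtain ⟨o, hwf, hdim⟩ := exists_order Y
  let := o
  have := hwf
  let : OrderBot (WithTop (Cells Y)) := WellFoundedLT.toOrderBot _
  let : SuccOrder (WithTop (Cells Y)) := SuccOrder.ofLinearWellFoundedLT _
  let A : WithTop (Cells Y) → Subfunctor Y := fun b =>
    Subfunctor.range f ⊔ ⨆ (c : {c : Cells Y // (c : WithTop (Cells Y)) < b}),
      Subfunctor.ofSection c.1.2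
  have memA : ∀ b p x, x ∈ (A b).obj p ↔ x ∈ (Subfunctor.range f).obj p ∨
      ∃ c : Cells Y, (c : WithTop (Cells Y)) < b ∧ x ∈ (Subfunctor.ofSection c.2).obj p := by
    intro b p x
    simp only [A, Subfunctor.max_obj, Set.mem_union, Subfunctor.iSup_obj, Set.mem_iUnion,
      Subtype.exists, exists_prop]
  have hA : Monotone A := by
    intro a b hab p x hx
    rw [memA] at hx
    show x ∈ (A b).obj p
    rw [memA]
    rcases hx with h | ⟨c, h, h'⟩
    · exact Or.inl h
    · exact Or.inr ⟨c, h.trans_le hab, h'⟩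
  have hbot : A ⊥ = Subfunctor.range f := by
    ext p x
    rw [memA]
    simp
  have htop : ∀ p x, x ∈ (A ⊤).obj p := by
    intro p x
    rw [memA]
    exact Or.inr ⟨⟨(p.unop.1.len, p.unop.2.len), x⟩, WithTop.coe_lt_top _,
      Subfunctor.mem_ofSection_obj _⟩
  have hle : Subfunctor.range f ≤ A ⊥ := hbot.ge
  have : IsIso (Subfunctor.lift f hle) := by
    rw [NatTrans.isIso_iff_isIso_app]
    intro p
    rw [isIso_iff_bijective]
    constructor
    · intro a b h
      have h2 : f.app p a = f.app p b := congrArg Subtype.val h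
      exact (mono_iff_injective (f.app p)).1 inferInstance h2
    · rintro ⟨x, hx⟩
      have hx' := hx
      rw [hbot] at hx'
      obtain ⟨a, ha⟩ := hx'
      exact ⟨a, Subtype.ext ha⟩
  have : IsIso (A ⊤).ι := by
    rw [NatTrans.isIso_iff_isIso_app]
    intro p
    rw [isIso_iff_bijective]
    exact ⟨Subtype.val_injective, fun x => ⟨⟨x, htop p x⟩, rfl⟩⟩
  -- the cocone
  let c : Cocone (subDiagram A hA) := ⟨Y, { app := fun b => (A b).ι }⟩
  have hcol : IsColimit c :=
    { desc := fun s => inv (A ⊤).ι ≫ s.ι.app ⊤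
      fac := fun s j => by
        have h1 : c.ι.app j = (subDiagram A hA).map (homOfLE le_top) ≫ (A ⊤).ι := rfl
        have h2 := s.w (homOfLE (le_top : j ≤ ⊤))
        have h3 : (A ⊤).ι ≫ inv (A ⊤).ι ≫ s.ι.app ⊤ = s.ι.app ⊤ := IsIso.hom_inv_id_assoc _ _
        exact (congrArg (fun z => (subDiagram A hA).map (homOfLE (le_top : j ≤ ⊤)) ≫ z) h3).trans h2
      uniq := fun s m hm => by
        rw [← hm ⊤]
        simp [c] }
  have main : S (c.ι.app ⊥) := by
    refine hS _ _ ?_ ?_ c hcol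
    · intro b hb
      change S (Subfunctor.homOfLe (hA (Order.le_succ b)))
      obtain ⟨d, rfl⟩ := WithTop.ne_top_iff_exists.1 (fun h : b = ⊤ => hb (h ▸ isMax_top))
      have hB : A (Order.succ (d : WithTop (Cells Y))) = A d ⊔ Subfunctor.ofSection d.2 := by
        ext p x
        rw [memA, Subfunctor.max_obj, Set.mem_union, memA]
        constructor
        · rintro (h | ⟨e, he, h⟩)
          · exact Or.inl (Or.inl h)
          · rw [Order.lt_succ_iff_of_not_isMax hb] at he
            rcases he.lt_or_eq with he | he
            · exact Or.inl (Or.inr ⟨e, he, h⟩)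
            · obtain rfl := WithTop.coe_injective he
              exact Or.inr h
        · rintro ((h | ⟨e, he, h⟩) | h)
          · exact Or.inl h
          · exact Or.inr ⟨e, he.trans_le (Order.le_succ _), h⟩
          · exact Or.inr ⟨d, Order.lt_succ_of_not_isMax hb, h⟩
      by_cases hd : d.2 ∈ (A d).obj _
      · have hBA : A (Order.succ (d : WithTop (Cells Y))) = A d := by
          rw [hB, sup_eq_left, Subfunctor.ofSection_le_iff]
          exact hd
        have : IsIso (Subfunctor.homOfLe (hA (Order.le_succ (d : WithTop (Cells Y))))) :=
          ⟨Subfunctor.homOfLe hBA.le, rfl, rfl⟩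
        exact iso_mem hS _
      · obtain ⟨t, b, hp⟩ := attach (A d) _ (hA (Order.le_succ _)) d.2 hd
          (face_mem _ d.2 (fun k' n' z hz => by
            rw [memA]
            exact Or.inr ⟨⟨(k', n'), z⟩, WithTop.coe_lt_coe.2 (hdim _ _ hz),
              Subfunctor.mem_ofSection_obj _⟩)) hB
        exact hS'.of_isPushout hp (hc _ _)
    · intro b hb
      have hbb : ⊥ < b := by
        rw [bot_lt_iff_ne_bot]
        rintro rfl
        exact hb.1 isMin_bot
      refine subDiagram_colimit A hA b ⟨⊥, hbb⟩ ?_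
      intro p x hx
      rw [memA] at hx
      rcases hx with h | ⟨e, he, h⟩
      · exact ⟨⊥, hbb, (memA _ _ _).2 (Or.inl h)⟩
      · refine ⟨Order.succ e, hb.succ_lt he, (memA _ _ _).2 (Or.inr ⟨e, ?_, h⟩)⟩
        exact Order.lt_succ_of_not_isMax (fun hm => (hm.not_lt he))
  have main' : S (A ⊥).ι := main
  have hsq : IsPushout (inv (Subfunctor.lift f hle)) (A ⊥).ι f (𝟙 Y) :=
    IsPushout.of_horiz_isIso ⟨by
      rw [IsIso.inv_comp_eq, Category.comp_id]
      rfl⟩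
  exact hS'.of_isPushout hsq main'

lemma mono_cobase : (MorphismProperty.monomorphisms BiSSet.{u}).IsStableUnderCobaseChange := by
  have : (MorphismProperty.monomorphisms (Type u)).IsStableUnderCobaseChange := by
    refine ⟨fun {A A' B B'} f g f' g' sq hf => ?_⟩
    have : Mono f := hf
    exact Types.pushoutCocone_inr_mono_of_isColimit sq.flip.isColimit
  rw [← MorphismProperty.functorCategory_monomorphisms]
  infer_instance

/-- The class of monomorphisms of bisimplicial sets contains the corner maps
(pushout-products of boundary inclusions under the external product), is stable
under cobase change and under transfinite composition, and it is the smallest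
such class: any class of morphisms containing the corner maps and stable under
cobase change and transfinite composition contains all monomorphisms. -/
theorem stmt15 :
    (∀ k n : ℕ, (MorphismProperty.monomorphisms BiSSet.{u}) (cornerMap k n)) ∧
    (MorphismProperty.monomorphisms BiSSet.{u}).IsStableUnderCobaseChange ∧
    IsStableUnderTransfiniteComposition (MorphismProperty.monomorphisms BiSSet.{u}) ∧
    (∀ S : MorphismProperty BiSSet.{u},
      (∀ k n : ℕ, S (cornerMap k n)) →
      S.IsStableUnderCobaseChange →
      IsStableUnderTransfiniteComposition S →
      MorphismProperty.monomorphisms BiSSet.{u} ≤ S) := by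
  refine ⟨fun k n => mono_corner k n, mono_cobase, ?_, fun S hc hS' hS X Y f hf => ?_⟩
  · intro β _ _ _ _ T hT hlim c hcol
    have hcont : T.IsWellOrderContinuous := ⟨fun b hb => hlim b hb⟩
    exact (MorphismProperty.monomorphisms BiSSet.{u}).transfiniteCompositionsOfShape_le β _
      ⟨{ F := T
         isoBot := Iso.refl _
         incl := c.ι
         isColimit := hcol
         fac := by simp
         map_mem := hT }⟩
  · have : Mono f := hf
    exact mono_mem hc hS' hS f

end Stmt15
end

section
/- Let i : A → B be a morphism of simplicial abelian groups which is a monomorphism and a weak equivalence (i.e. its image under the normalized Moore complex functor is a quasi-isomorphism of chain complexes of abelian groups). Then for any morphism f : A → C of simplicial abelian groups, the cobase change C → B ⊔_A C of i along f (the pushout of i along f in the category of simplicial abelian groups) is again a monomorphism and a weak equivalence. -/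
open CategoryTheory CategoryTheory.Limits AlgebraicTopology

universe u

lemma quasiIso_f_of_acyclic {D : Type*} [Category* D] [Abelian D]
    {S : ShortComplex (ChainComplex D ℕ)} (hS : S.ShortExact) (h : S.X₃.Acyclic) :
    QuasiIso S.f := by
  rw [quasiIso_iff]
  intro j
  rw [quasiIsoAt_iff_isIso_homologyMap]
  have hz : ∀ k, IsZero (S.X₃.homology k) := fun k => (h k).isZero_homology
  have h1 : Mono (HomologicalComplex.homologyMap S.f j) :=
    (hS.homology_exact₁ (j + 1) j rfl).mono_g ((hz _).eq_of_src _ _)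
  have h2 : Epi (HomologicalComplex.homologyMap S.f j) :=
    (hS.homology_exact₂ j).epi_f ((hz _).eq_of_tgt _ _)
  exact isIso_of_mono_of_epi _

lemma quasiIso_of_isPushout {D : Type*} [Category* D] [Abelian D]
    {A B C P : ChainComplex D ℕ} {i : A ⟶ B} {f : A ⟶ C} {g : B ⟶ P} {j : C ⟶ P}
    (sq : IsPushout i f g j) [Mono i] [Mono j] (hi : QuasiIso i) : QuasiIso j := by
  have h1 : (ShortComplex.mk i (cokernel.π i) (cokernel.condition i)).ShortExact :=
    { exact := ShortComplex.exact_cokernel i }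
  have h2 : (ShortComplex.mk j (cokernel.π j) (cokernel.condition j)).ShortExact :=
    { exact := ShortComplex.exact_cokernel j }
  have h3 : (cokernel i).Acyclic := h1.acyclic_X₃ hi
  refine quasiIso_f_of_acyclic h2 ?_
  let p : P ⟶ cokernel i := sq.desc (cokernel.π i) 0 (by simp)
  have e1 : cokernel.desc j p (by simp [p]) ≫
      cokernel.map i j f g sq.w = 𝟙 _ := by
    apply coequalizer.hom_ext
    apply sq.hom_ext <;> simp [p]
  intro k
  have h4 := h3 k
  rw [HomologicalComplex.exactAt_iff_isZero_homology] at h4 ⊢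
  refine (IsZero.iff_id_eq_zero _).2 ?_
  have e2 := congrArg (fun t => HomologicalComplex.homologyMap t k) e1
  simp only [HomologicalComplex.homologyMap_comp, HomologicalComplex.homologyMap_id] at e2
  rw [← e2, h4.eq_of_src (HomologicalComplex.homologyMap _ k) 0, comp_zero]

lemma quasiIso_moore_iff {D : Type*} [Category* D] [Abelian D]
    {X Y : SimplicialObject D} (f : X ⟶ Y) :
    QuasiIso ((normalizedMooreComplex D).map f) ↔
      QuasiIso ((alternatingFaceMapComplex D).map f) := by
  have hq : ∀ Z : SimplicialObject D, QuasiIso (inclusionOfMooreComplexMap Z) := fun Z =>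
    (DoldKan.homotopyEquivNormalizedMooreComplexAlternatingFaceMapComplex (Y := Z)).quasiIso_hom
  have := hq X
  have := hq Y
  rw [← quasiIso_iff_comp_right _ (inclusionOfMooreComplexMap Y),
    ← quasiIso_iff_comp_left (inclusionOfMooreComplexMap X)]
  have e : (normalizedMooreComplex D).map f ≫ inclusionOfMooreComplexMap Y =
      inclusionOfMooreComplexMap X ≫ (alternatingFaceMapComplex D).map f :=
    (inclusionOfMooreComplex D).naturality f
  rw [e]

theorem stmt16 {A B C : SimplicialObject AddCommGrpCat.{u}} (i : A ⟶ B) (f : A ⟶ C)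
    (hmono : Mono i)
    (hwe : QuasiIso ((normalizedMooreComplex AddCommGrpCat.{u}).map i)) :
    Mono (pushout.inr i f) ∧
      QuasiIso ((normalizedMooreComplex AddCommGrpCat.{u}).map (pushout.inr i f)) := by
  let _ : Abelian (SimplicialObject AddCommGrpCat.{u}) :=
    inferInstanceAs (Abelian (SimplexCategoryᵒᵖ ⥤ AddCommGrpCat.{u}))
  have hm : Mono (pushout.inr i f) := inferInstance
  refine ⟨hm, ?_⟩
  rw [quasiIso_moore_iff] at hwe ⊢
  have : PreservesColimitsOfShape WalkingSpan
      (alternatingFaceMapComplex AddCommGrpCat.{u}) :=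
    HomologicalComplex.preservesColimitsOfShape_of_eval _ (fun n =>
      inferInstanceAs (PreservesColimitsOfShape WalkingSpan
        ((evaluation SimplexCategoryᵒᵖ AddCommGrpCat.{u}).obj
          (Opposite.op (SimplexCategory.mk n)))))
  exact quasiIso_of_isPushout
    ((IsPushout.of_hasPushout i f).map (alternatingFaceMapComplex AddCommGrpCat.{u})) hwe
end
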